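/- Let α > 0 and let φ(x) = a₀ (sech(b₀ x))^{4/α} with a₀ = ((3α³ + 22α² + 48α + 32)/(2(α² + 4α + 8)²))^{1/α}, b₀ = α/(2√(α² + 4α + 8)), and ω₀ = 4(α² + 4α + 4)/(α⁴ + 8α³ + 32α² + 64α + 64). Then there exist ε > 0, δ > 0, and a family (φ_ω)_{ω ∈ (ω₀−ε, ω₀+ε)} of even, strictly positive, four times continuously differentiable functions φ_ω : ℝ → ℝ, with φ_ω and its derivatives up to order four square-integrable, such that: (i) φ_{ω₀} = φ; (ii) for each ω ∈ (ω₀−ε, ω₀+ε), φ_ω''''(x) − φ_ω''(x) + ω φ_ω(x) − φ_ω(x)^{α+1} = 0 for all x ∈ ℝ; (iii) for each such ω, Σ_{k=0}^{4} ∫_ℝ (φ_ω^{(k)}(x) − φ^{(k)}(x))² dx < δ², and φ_ω is the unique even solution of the equation with this property; and (iv) the map ω ↦ φ_ω is continuous with respect to the distance d(f, g)² = Σ_{k=0}^{4} ∫_ℝ (f^{(k)} − g^{(k)})² dx. -/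

import Mathlib

open Real MeasureTheory

/-- The squared H⁴-type distance `d(f,g)² = Σ_{k=0}^{4} ∫ (f⁽ᵏ⁾ - g⁽ᵏ⁾)²`. -/
noncomputable def distH4sq (f g : ℝ → ℝ) : ℝ :=
  ∑ k ∈ Finset.range 5, ∫ x : ℝ, (iteratedDeriv k f x - iteratedDeriv k g x)^2

section ExpConv
open Set Filter Topology

theorem cosh_mul_le_exp_mul_cosh {κ : ℝ} (hκ : 0 ≤ κ) {x y : ℝ} (h : y ≤ x) :
    cosh (κ * x) ≤ exp (κ * (x - y)) * cosh (κ * y) := by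
  have h1 : exp (κ * x) = exp (κ * (x - y)) * exp (κ * y) := by rw [← exp_add]; ring_nf
  have h2 : exp (-(κ * x)) ≤ exp (κ * (x - y)) * exp (-(κ * y)) := by
    rw [← exp_add]
    apply exp_le_exp.mpr
    nlinarith [mul_nonneg hκ (sub_nonneg.mpr h)]
  rw [cosh_eq, cosh_eq]
  linarith

/-- The bounded solution operator of `y' + a y = F`. -/
noncomputable def expConv (a : ℝ) (F : ℝ → ℝ) (x : ℝ) : ℝ :=
  exp (-(a * x)) * ∫ y in Iic x, exp (a * y) * F y

theorem integrableOn_exp_mul_of_bounded {a : ℝ} (ha : 0 < a) {F : ℝ → ℝ} (hF : Continuous F)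
    {C : ℝ} (hC : ∀ y, |F y| ≤ C) (x : ℝ) :
    IntegrableOn (fun y => exp (a * y) * F y) (Iic x) := by
  refine Integrable.mono' ((integrableOn_exp_mul_Iic ha x).const_mul C)
    (by fun_prop) (Eventually.of_forall fun y => ?_)
  rw [norm_mul, norm_eq_abs, norm_eq_abs, abs_exp, mul_comm]
  exact mul_le_mul_of_nonneg_right (hC y) (exp_pos _).le

theorem hasDerivAt_expConv {a : ℝ} (ha : 0 < a) {F : ℝ → ℝ} (hF : Continuous F)
    {C : ℝ} (hC : ∀ y, |F y| ≤ C) (x : ℝ) :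
    HasDerivAt (expConv a F) (F x - a * expConv a F x) x := by
  have hInt := integrableOn_exp_mul_of_bounded ha hF hC
  have hc : Continuous fun y => exp (a * y) * F y := by fun_prop
  have h1 : ∀ z, ∫ y in Iic z, exp (a * y) * F y
      = (∫ y in Iic 0, exp (a * y) * F y) + ∫ y in (0:ℝ)..z, exp (a * y) * F y := fun z => by
    rw [← intervalIntegral.integral_Iic_sub_Iic (hInt 0) (hInt z)]; ring
  have h2 : HasDerivAt (fun z => ∫ y in Iic z, exp (a * y) * F y) (exp (a * x) * F x) x := by
    rw [funext h1]
    exact (hc.integral_hasStrictDerivAt 0 x).hasDerivAt.const_add _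
  have h3 : HasDerivAt (fun z : ℝ => exp (-(a * z))) (exp (-(a * x)) * (-a)) x := by
    have := ((hasDerivAt_id x).const_mul a).neg.exp
    simpa using this
  have h4 := h3.mul h2
  have h5 : exp (-(a * x)) * exp (a * x) = 1 := by rw [← exp_add]; simp
  refine h4.congr_deriv ?_
  unfold expConv
  linear_combination F x * h5

theorem continuous_expConv {a : ℝ} (ha : 0 < a) {F : ℝ → ℝ} (hF : Continuous F)
    {C : ℝ} (hC : ∀ y, |F y| ≤ C) : Continuous (expConv a F) :=
  continuous_iff_continuousAt.mpr fun x => (hasDerivAt_expConv ha hF hC x).continuousAt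

theorem abs_expConv_le {a κ C : ℝ} (hκ : 0 ≤ κ) (h : κ < a) {F : ℝ → ℝ} (hF : Continuous F)
    (hC : ∀ y, |F y| ≤ C / cosh (κ * y)) (x : ℝ) :
    |expConv a F x| ≤ C / (a - κ) / cosh (κ * x) := by
  have ha : 0 < a := by linarith
  have hC0 : 0 ≤ C := by
    have := (abs_nonneg _).trans (hC 0)
    simpa using this
  have hCb : ∀ y, |F y| ≤ C := fun y => (hC y).trans (div_le_self hC0 (one_le_cosh _))
  have hInt := integrableOn_exp_mul_of_bounded ha hF hCb x
  have h1 : ‖∫ y in Iic x, exp (a * y) * F y‖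
      ≤ ∫ y in Iic x, C * exp (κ * x) / cosh (κ * x) * exp ((a - κ) * y) := by
    refine norm_integral_le_of_norm_le
      ((integrableOn_exp_mul_Iic (by linarith) x).const_mul _) ?_
    refine (ae_restrict_mem measurableSet_Iic).mono fun y hy => ?_
    rw [norm_mul, norm_eq_abs, norm_eq_abs, abs_exp]
    have hy' : y ≤ x := hy
    have h2 := cosh_mul_le_exp_mul_cosh hκ hy'
    have h3 : |F y| ≤ C * exp (κ * (x - y)) / cosh (κ * x) := by
      refine (hC y).trans ?_
      rw [div_le_div_iff₀ (cosh_pos _) (cosh_pos _)]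
      nlinarith
    calc exp (a * y) * |F y| ≤ exp (a * y) * (C * exp (κ * (x - y)) / cosh (κ * x)) := by gcongr
      _ = _ := by
        have : exp (a * y) * exp (κ * (x - y)) = exp (κ * x) * exp ((a - κ) * y) := by
          rw [← exp_add, ← exp_add]; ring_nf
        rw [mul_div_assoc', div_mul_eq_mul_div]
        congr 1
        linear_combination C * this
  rw [integral_const_mul, integral_exp_mul_Iic (by linarith)] at h1
  unfold expConv
  rw [abs_mul, abs_exp]
  rw [norm_eq_abs] at h1
  calc _ ≤ exp (-(a * x)) * (C * exp (κ * x) / cosh (κ * x) * (exp ((a - κ) * x) / (a - κ))) := by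
        gcongr
    _ = _ := by
      have h5 : exp (-(a * x)) * (exp (κ * x) * exp ((a - κ) * x)) = 1 := by
        rw [← exp_add, ← exp_add, ← exp_zero]; ring_nf
      have h6 : a - κ ≠ 0 := by linarith
      generalize exp (-(a * x)) = u, exp (κ * x) = v, exp ((a - κ) * x) = w at h5 ⊢
      field_simp
      linear_combination C * h5

theorem neg_le_expConv {a M C : ℝ} (ha : 0 < a) {F : ℝ → ℝ} (hF : Continuous F)
    (hC : ∀ y, |F y| ≤ C) (hM : ∀ y, -M ≤ F y) (x : ℝ) : -(M / a) ≤ expConv a F x := by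
  have h1 : ∫ y in Iic x, exp (a * y) * (-M) ≤ ∫ y in Iic x, exp (a * y) * F y :=
    integral_mono (f := fun y => exp (a * y) * (-M)) ((integrableOn_exp_mul_Iic ha x).mul_const _)
      (integrableOn_exp_mul_of_bounded ha hF hC x)
      fun y => mul_le_mul_of_nonneg_left (hM y) (exp_pos _).le
  rw [integral_mul_const, integral_exp_mul_Iic ha] at h1
  have h5 : exp (-(a * x)) * exp (a * x) = 1 := by rw [← exp_add]; simp
  calc -(M / a) = exp (-(a * x)) * (exp (a * x) / a * (-M)) := by
        field_simp; linear_combination M * h5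
    _ ≤ _ := mul_le_mul_of_nonneg_left h1 (exp_pos _).le

theorem expConv_nonneg {a C : ℝ} (ha : 0 < a) {F : ℝ → ℝ} (hF : Continuous F)
    (hC : ∀ y, |F y| ≤ C) (h0 : ∀ y, 0 ≤ F y) (x : ℝ) : 0 ≤ expConv a F x := by
  simpa using neg_le_expConv (M := 0) ha hF hC (by simpa using h0) x

theorem expConv_pos {a C : ℝ} (ha : 0 < a) {F : ℝ → ℝ} (hF : Continuous F)
    (hC : ∀ y, |F y| ≤ C) (h0 : ∀ y, 0 ≤ F y) {x₀ x : ℝ} (hx : x₀ < x) (hpos : 0 < F x₀) :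
    0 < expConv a F x := by
  refine mul_pos (exp_pos _) ?_
  have hInt := integrableOn_exp_mul_of_bounded ha hF hC x
  rw [setIntegral_pos_iff_support_of_nonneg_ae
    (Eventually.of_forall fun y => mul_nonneg (exp_pos _).le (h0 y)) hInt]
  have hopen : IsOpen ({y | 0 < F y} ∩ Iio x) := (isOpen_lt continuous_const hF).inter isOpen_Iio
  refine (hopen.measure_pos volume ⟨x₀, hpos, hx⟩).trans_le (measure_mono ?_)
  rintro y ⟨hy, hyx⟩
  exact ⟨(mul_pos (exp_pos _) hy).ne', le_of_lt (show y < x from hyx)⟩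

theorem eq_expConv_of_hasDerivAt {a C D : ℝ} (ha : 0 < a) {F g : ℝ → ℝ} (hF : Continuous F)
    (hC : ∀ y, |F y| ≤ C) (hg : ∀ x, HasDerivAt g (F x - a * g x) x) (hD : ∀ x, |g x| ≤ D) :
    g = expConv a F := by
  have hb : ∀ x, |expConv a F x| ≤ C / a := fun x => by
    simpa using abs_expConv_le le_rfl ha hF (C := C) (by simpa using hC) x
  have hd : ∀ x, HasDerivAt (fun x => exp (a * x) * (g x - expConv a F x)) 0 x := fun x => by
    have h1 : HasDerivAt (fun x => exp (a * x)) (exp (a * x) * a) x := by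
      simpa using ((hasDerivAt_id x).const_mul a).exp
    refine (h1.mul ((hg x).sub (hasDerivAt_expConv ha hF hC x))).congr_deriv ?_
    simp only [Pi.sub_apply]
    ring
  have hconst : ∀ x y, exp (a * x) * (g x - expConv a F x) = exp (a * y) * (g y - expConv a F y) :=
    is_const_of_deriv_eq_zero (fun x => (hd x).differentiableAt) fun x => (hd x).deriv
  funext x
  have hlim : Tendsto (fun y => exp (a * y) * (g y - expConv a F y)) atBot (𝓝 0) := by
    refine squeeze_zero_norm (a := fun y => exp (a * y) * (D + C / a)) (fun y => ?_) ?_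
    · rw [norm_mul, norm_eq_abs, norm_eq_abs, abs_exp]
      gcongr
      exact (abs_sub _ _).trans (add_le_add (hD y) (hb y))
    · rw [← zero_mul (D + C / a)]
      exact (tendsto_exp_atBot.comp (tendsto_id.const_mul_atBot ha)).mul_const _
  have h0 : exp (a * x) * (g x - expConv a F x) = 0 := by
    refine tendsto_nhds_unique ?_ hlim
    rw [funext fun y => hconst y x]
    exact tendsto_const_nhds
  have := (mul_eq_zero.mp h0).resolve_left (exp_pos _).ne'
  linarith

theorem expConv_add {a C D : ℝ} (ha : 0 < a) {F G : ℝ → ℝ} (hF : Continuous F) (hG : Continuous G)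
    (hC : ∀ y, |F y| ≤ C) (hD : ∀ y, |G y| ≤ D) (x : ℝ) :
    expConv a (fun y => F y + G y) x = expConv a F x + expConv a G x := by
  unfold expConv
  rw [← mul_add, ← integral_add (integrableOn_exp_mul_of_bounded ha hF hC x)
    (integrableOn_exp_mul_of_bounded ha hG hD x)]
  simp_rw [mul_add]

theorem expConv_const_mul (a c : ℝ) (F : ℝ → ℝ) (x : ℝ) :
    expConv a (fun y => c * F y) x = c * expConv a F x := by
  unfold expConv
  simp_rw [mul_left_comm _ c, integral_const_mul]
  ring

end ExpConv

section Weighted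
open Set Filter Topology BoundedContinuousFunction

theorem abs_div_cosh_le (m : ℝ) (f : ℝ →ᵇ ℝ) (y : ℝ) : |f y / cosh (m * y)| ≤ ‖f‖ / cosh (m * y) := by
  rw [abs_div, abs_of_pos (cosh_pos _)]
  exact div_le_div_of_nonneg_right (f.norm_coe_le_norm y) (cosh_pos _).le

theorem abs_div_cosh_le_norm (m : ℝ) (f : ℝ →ᵇ ℝ) (y : ℝ) : |f y / cosh (m * y)| ≤ ‖f‖ :=
  (abs_div_cosh_le m f y).trans (div_le_self (norm_nonneg _) (one_le_cosh _))

theorem continuous_div_cosh (m : ℝ) (f : ℝ →ᵇ ℝ) : Continuous fun y => f y / cosh (m * y) :=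
  f.continuous.div (by fun_prop) fun y => (cosh_pos _).ne'

theorem abs_cosh_mul_expConv_le {a m : ℝ} (hm : 0 ≤ m) (h : m < a) (f : ℝ →ᵇ ℝ) (x : ℝ) :
    ‖cosh (m * x) * expConv a (fun y => f y / cosh (m * y)) x‖ ≤ ‖f‖ / (a - m) := by
  have h1 := abs_expConv_le hm h (continuous_div_cosh m f) (abs_div_cosh_le m f) x
  rw [norm_mul, norm_eq_abs, norm_eq_abs, abs_of_pos (cosh_pos _)]
  rwa [le_div_iff₀ (cosh_pos _), mul_comm] at h1

/-- The operator `expConv a` conjugated by the weight `cosh (m x)`, on bounded continuous functions. -/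
noncomputable def wConv (a m : ℝ) (hm : 0 ≤ m) (h : m < a) : (ℝ →ᵇ ℝ) →L[ℝ] (ℝ →ᵇ ℝ) :=
  LinearMap.mkContinuous
    { toFun := fun f => BoundedContinuousFunction.ofNormedAddCommGroup
        (fun x => cosh (m * x) * expConv a (fun y => f y / cosh (m * y)) x)
        ((by fun_prop : Continuous fun x => cosh (m * x)).mul
          (continuous_expConv (hm.trans_lt h) (continuous_div_cosh m f) (abs_div_cosh_le_norm m f)))
        (‖f‖ / (a - m)) (abs_cosh_mul_expConv_le hm h f)
      map_add' := fun f g => by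
        ext x
        simp only [BoundedContinuousFunction.coe_ofNormedAddCommGroup,
          BoundedContinuousFunction.coe_add, Pi.add_apply, add_div]
        rw [expConv_add (hm.trans_lt h) (continuous_div_cosh m f) (continuous_div_cosh m g)
          (abs_div_cosh_le_norm m f) (abs_div_cosh_le_norm m g), mul_add]
      map_smul' := fun c f => by
        ext x
        simp only [BoundedContinuousFunction.coe_ofNormedAddCommGroup,
          BoundedContinuousFunction.coe_smul, smul_eq_mul, mul_div_assoc, RingHom.id_apply]
        rw [expConv_const_mul]
        ring }
    (1 / (a - m)) (fun f => by
      rw [one_div_mul_eq_div]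
      exact (BoundedContinuousFunction.norm_le
        (div_nonneg (norm_nonneg _) (by linarith))).mpr (abs_cosh_mul_expConv_le hm h f))

theorem wConv_apply {a m : ℝ} (hm : 0 ≤ m) (h : m < a) (f : ℝ →ᵇ ℝ) (x : ℝ) :
    wConv a m hm h f x = cosh (m * x) * expConv a (fun y => f y / cosh (m * y)) x := rfl

theorem wConv_div_cosh {a m : ℝ} (hm : 0 ≤ m) (h : m < a) (f : ℝ →ᵇ ℝ) :
    (fun x => wConv a m hm h f x / cosh (m * x)) = expConv a (fun y => f y / cosh (m * y)) := by
  funext x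
  rw [wConv_apply, mul_div_cancel_left₀ _ (cosh_pos _).ne']

theorem hasDerivAt_wConv_div_cosh {a m : ℝ} (hm : 0 ≤ m) (h : m < a) (f : ℝ →ᵇ ℝ) (x : ℝ) :
    HasDerivAt (fun x => wConv a m hm h f x / cosh (m * x))
      (f x / cosh (m * x) - a * (wConv a m hm h f x / cosh (m * x))) x := by
  have := hasDerivAt_expConv (hm.trans_lt h) (continuous_div_cosh m f) (abs_div_cosh_le_norm m f) x
  rw [← wConv_div_cosh hm h f] at this
  exact this

/-- The reflection `f ↦ f (-·)`. -/
noncomputable def reflectBCF : (ℝ →ᵇ ℝ) →L[ℝ] (ℝ →ᵇ ℝ) :=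
  BoundedContinuousFunction.compContinuousCLM ℝ ℝ ⟨fun x : ℝ => -x, continuous_neg⟩

@[simp] theorem reflectBCF_apply (f : ℝ →ᵇ ℝ) (x : ℝ) : reflectBCF f x = f (-x) := rfl

/-- The conjugate of `wConv` under the reflection. -/
noncomputable def wConvRefl (a m : ℝ) (hm : 0 ≤ m) (h : m < a) : (ℝ →ᵇ ℝ) →L[ℝ] (ℝ →ᵇ ℝ) :=
  reflectBCF ∘L wConv a m hm h ∘L reflectBCF

theorem hasDerivAt_wConvRefl_div_cosh {a m : ℝ} (hm : 0 ≤ m) (h : m < a) (f : ℝ →ᵇ ℝ) (x : ℝ) :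
    HasDerivAt (fun x => wConvRefl a m hm h f x / cosh (m * x))
      (a * (wConvRefl a m hm h f x / cosh (m * x)) - f x / cosh (m * x)) x := by
  have h1 := (hasDerivAt_wConv_div_cosh hm h (reflectBCF f) (-x)).scomp x (hasDerivAt_neg x)
  have h2 : (fun x => wConvRefl a m hm h f x / cosh (m * x))
      = (fun x => wConv a m hm h (reflectBCF f) x / cosh (m * x)) ∘ Neg.neg := by
    funext y
    simp [wConvRefl]
  rw [h2]
  refine h1.congr_deriv ?_
  simp only [wConvRefl, ContinuousLinearMap.comp_apply, reflectBCF_apply, mul_neg, cosh_neg,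
    neg_neg, smul_eq_mul]
  ring

theorem inv_cosh_mul_inv_cosh_le (c m y : ℝ) :
    1 / (cosh (c * y) * cosh (m * y)) ≤ 2 / cosh ((m + c) * y) := by
  rw [div_le_div_iff₀ (mul_pos (cosh_pos _) (cosh_pos _)) (cosh_pos _), add_mul, cosh_add]
  have h1 := abs_le.mp (abs_le_of_sq_le_sq (a := sinh (m * y)) (b := cosh (m * y))
    (by nlinarith [cosh_sq (m * y)]) (cosh_pos _).le)
  have h2 := abs_le.mp (abs_le_of_sq_le_sq (a := sinh (c * y)) (b := cosh (c * y))
    (by nlinarith [cosh_sq (c * y)]) (cosh_pos _).le)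
  nlinarith [mul_nonneg (sub_nonneg.mpr h1.2) (by linarith : 0 ≤ cosh (c * y) + sinh (c * y)),
    mul_nonneg (sub_nonneg.mpr h2.2) (by linarith : 0 ≤ cosh (m * y) + sinh (m * y))]

theorem cosh_mul_cosh_le {c m : ℝ} (hc : 0 ≤ c) (hm : 0 ≤ m) (y : ℝ) :
    cosh (c * y) * cosh (m * y) ≤ cosh ((m + c) * y) := by
  rw [add_mul, cosh_add]
  have : 0 ≤ sinh (m * y) * sinh (c * y) := by
    rcases le_total 0 y with h | h
    · exact mul_nonneg (sinh_nonneg_iff.mpr (by positivity)) (sinh_nonneg_iff.mpr (by positivity))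
    · exact mul_nonneg_of_nonpos_of_nonpos (sinh_nonpos_iff.mpr (mul_nonpos_of_nonneg_of_nonpos hm h))
        (sinh_nonpos_iff.mpr (mul_nonpos_of_nonneg_of_nonpos hc h))
  linarith [mul_comm (cosh (c * y)) (cosh (m * y))]

theorem abs_wConv_mul_le {a m c C : ℝ} (hm : 0 ≤ m) (h : m < a) (hc : 0 ≤ c) (hmc : m + c < a)
    {p : ℝ →ᵇ ℝ} (hp : ∀ y, |p y| ≤ C / cosh (c * y)) (f : ℝ →ᵇ ℝ) (x : ℝ) :
    |wConv a m hm h (p * f) x| ≤ 2 * C / (a - (m + c)) * ‖f‖ / cosh (c * x) := by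
  have hC : 0 ≤ C := by simpa using (abs_nonneg _).trans (hp 0)
  have h1 : ∀ y, |(p * f) y / cosh (m * y)| ≤ 2 * C * ‖f‖ / cosh ((m + c) * y) := fun y => by
    rw [abs_div, abs_of_pos (cosh_pos (m * y)), BoundedContinuousFunction.mul_apply, abs_mul]
    calc |p y| * |f y| / cosh (m * y) ≤ C / cosh (c * y) * ‖f‖ / cosh (m * y) := by
          gcongr
          · exact hp y
          · exact f.norm_coe_le_norm y
      _ = C * ‖f‖ * (1 / (cosh (c * y) * cosh (m * y))) := by
          have := (cosh_pos (c * y)).ne'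
          have := (cosh_pos (m * y)).ne'
          field_simp
      _ ≤ C * ‖f‖ * (2 / cosh ((m + c) * y)) := by
          exact mul_le_mul_of_nonneg_left (inv_cosh_mul_inv_cosh_le c m y) (by positivity)
      _ = _ := by ring
  have h2 := abs_expConv_le (by linarith) hmc (continuous_div_cosh m (p * f)) h1 x
  rw [wConv_apply, abs_mul, abs_of_pos (cosh_pos (m * x)), le_div_iff₀ (cosh_pos _)]
  rw [le_div_iff₀ (cosh_pos _)] at h2
  calc _ = |expConv a (fun y => (p * f) y / cosh (m * y)) x| * (cosh (c * x) * cosh (m * x)) := by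
        ring
    _ ≤ |expConv a (fun y => (p * f) y / cosh (m * y)) x| * cosh ((m + c) * x) := by
        gcongr
        exact cosh_mul_cosh_le hc hm x
    _ ≤ _ := h2
    _ = _ := by ring

theorem lipschitz_wConv {a m : ℝ} (hm : 0 ≤ m) (h : m < a) (f : ℝ →ᵇ ℝ) (x y : ℝ) :
    |wConv a m hm h f x - wConv a m hm h f y| ≤ ((m + a) * ‖wConv a m hm h f‖ + ‖f‖) * |x - y| := by
  set g := wConv a m hm h f
  have hd : ∀ z, HasDerivAt g (m * (sinh (m * z) / cosh (m * z)) * g z + (f z - a * g z)) z := by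
    intro z
    have h1 : HasDerivAt (fun z => cosh (m * z)) (sinh (m * z) * m) z := by
      simpa using ((hasDerivAt_id z).const_mul m).cosh
    have h2 := h1.mul (hasDerivAt_wConv_div_cosh hm h f z)
    have h3 : ∀ z, cosh (m * z) ≠ 0 := fun z => (cosh_pos _).ne'
    have h4 : ((fun z => cosh (m * z)) * fun x => wConv a m hm h f x / cosh (m * x)) = g := by
      funext z
      simp only [Pi.mul_apply]
      rw [mul_div_cancel₀ _ (h3 z)]
    rw [h4] at h2
    refine h2.congr_deriv ?_
    have := h3 z
    change sinh (m * z) * m * (g z / _) + cosh (m * z) * (_ - a * (g z / _)) = _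
    field_simp
  have hb : ∀ z, ‖m * (sinh (m * z) / cosh (m * z)) * g z + (f z - a * g z)‖
      ≤ (m + a) * ‖g‖ + ‖f‖ := by
    intro z
    have hg := g.norm_coe_le_norm z
    have hf := f.norm_coe_le_norm z
    have ht : |sinh (m * z) / cosh (m * z)| ≤ 1 := by
      rw [abs_div, abs_of_pos (cosh_pos (m * z)), div_le_one (cosh_pos _)]
      exact abs_le_of_sq_le_sq (by nlinarith [cosh_sq (m * z)]) (cosh_pos _).le
    rw [norm_eq_abs] at *
    have e1 : |m * (sinh (m * z) / cosh (m * z)) * g z| ≤ m * 1 * ‖g‖ := by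
      rw [abs_mul, abs_mul, abs_of_nonneg hm]
      gcongr
    have e2 : |a * g z| ≤ a * ‖g‖ := by
      rw [abs_mul, abs_of_pos (hm.trans_lt h)]
      gcongr
      linarith
    calc _ ≤ |m * (sinh (m * z) / cosh (m * z)) * g z| + (|f z| + |a * g z|) :=
          (abs_add_le _ _).trans (by gcongr; exact abs_sub _ _)
      _ ≤ _ := by linarith
  have := convex_univ.norm_image_sub_le_of_norm_hasDerivWithin_le
    (fun z _ => (hd z).hasDerivWithinAt) (fun z _ => hb z) (mem_univ y) (mem_univ x)
  simpa [norm_eq_abs] using this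

/-- Restriction to a compact interval followed by constant extension. -/
noncomputable def restrictIcc (n : ℕ) : (ℝ →ᵇ ℝ) →L[ℝ] (Icc (-(n:ℝ)) n →ᵇ ℝ) :=
  BoundedContinuousFunction.compContinuousCLM ℝ ℝ ⟨Subtype.val, continuous_subtype_val⟩

theorem neg_natCast_le (n : ℕ) : -(n:ℝ) ≤ n := by
  have : (0:ℝ) ≤ n := n.cast_nonneg
  linarith

/-- Constant extension of a function on a compact interval. -/
noncomputable def extendIcc (n : ℕ) : (Icc (-(n:ℝ)) n →ᵇ ℝ) →L[ℝ] (ℝ →ᵇ ℝ) :=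
  BoundedContinuousFunction.compContinuousCLM ℝ ℝ
    ⟨projIcc (-(n:ℝ)) n (neg_natCast_le n), continuous_projIcc⟩

theorem isCompactOperator_restrictIcc_wConv {a m : ℝ} (hm : 0 ≤ m) (h : m < a) (n : ℕ) :
    IsCompactOperator (restrictIcc n ∘L wConv a m hm h) := by
  set K := wConv a m hm h
  refine (isCompactOperator_iff_isCompact_closure_image_closedBall
    (restrictIcc n ∘L K).toLinearMap one_pos).mpr ?_
  refine BoundedContinuousFunction.arzela_ascoli (Metric.closedBall 0 ‖K‖)
    (isCompact_closedBall _ _) _ ?_ ?_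
  · rintro _ x ⟨f, hf, rfl⟩
    rw [mem_closedBall_zero_iff] at hf ⊢
    exact ((K f).norm_coe_le_norm _).trans ((K.le_opNorm f).trans
      (mul_le_of_le_one_right (norm_nonneg _) hf))
  · refine (LipschitzWith.uniformEquicontinuous _ ((m + a) * ‖K‖ + 1).toNNReal ?_).equicontinuous
    rintro ⟨_, f, hf, rfl⟩
    rw [mem_closedBall_zero_iff] at hf
    refine LipschitzWith.of_dist_le_mul fun x y => ?_
    have h1 := lipschitz_wConv hm h f x y
    have h2 : ‖K f‖ ≤ ‖K‖ := (K.le_opNorm f).trans (mul_le_of_le_one_right (norm_nonneg _) hf)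
    have h3 : 0 ≤ m + a := by linarith
    rw [Real.coe_toNNReal _ (by positivity)]
    refine h1.trans ?_
    rw [Subtype.dist_eq, Real.dist_eq]
    gcongr

theorem isCompactOperator_wConv_mul {a m c C : ℝ} (hm : 0 ≤ m) (h : m < a) (hc : 0 < c)
    {p : ℝ →ᵇ ℝ} (hp : ∀ y, |p y| ≤ C / cosh (c * y)) :
    IsCompactOperator (wConv a m hm h ∘L ContinuousLinearMap.mul ℝ (ℝ →ᵇ ℝ) p) := by
  have hC : 0 ≤ C := by simpa using (abs_nonneg _).trans (hp 0)
  wlog hmc : m + c < a generalizing c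
  · refine this (c := (a - m) / 2) (by linarith) (fun y => (hp y).trans ?_) (by linarith)
    have h1 : (a - m) / 2 ≤ c := by linarith
    gcongr
    rw [cosh_le_cosh, abs_mul, abs_mul, abs_of_pos hc, abs_of_pos (by linarith : 0 < (a - m) / 2)]
    gcongr
  set K := wConv a m hm h ∘L ContinuousLinearMap.mul ℝ (ℝ →ᵇ ℝ) p
  set D := 2 * C / (a - (m + c))
  have hD : 0 ≤ D := div_nonneg (by positivity) (by linarith)
  have hK : ∀ f x, |K f x| ≤ D * ‖f‖ / cosh (c * x) := fun f x =>
    abs_wConv_mul_le hm h hc.le hmc hp f x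
  refine isCompactOperator_of_tendsto (l := atTop)
    (F := fun n : ℕ => extendIcc n ∘L restrictIcc n ∘L K) ?_ (Eventually.of_forall fun n => ?_)
  · rw [tendsto_iff_norm_sub_tendsto_zero]
    have hlim : Tendsto (fun n : ℕ => 2 * D / cosh (c * n)) atTop (𝓝 0) := by
      refine Tendsto.div_atTop tendsto_const_nhds ?_
      refine tendsto_atTop_mono (fun n : ℕ => ?_) ((tendsto_exp_atTop.comp
        (tendsto_natCast_atTop_atTop.const_mul_atTop hc)).atTop_div_const two_pos)
      rw [cosh_eq]
      have := exp_pos (-(c * n))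
      simp only [Function.comp]
      linarith
    refine squeeze_zero (fun n => norm_nonneg _) (fun n => ?_) hlim
    refine ContinuousLinearMap.opNorm_le_bound _ (by have := cosh_pos (c * n); positivity) fun f => ?_
    rw [BoundedContinuousFunction.norm_le (by have := cosh_pos (c * n); positivity)]
    intro x
    have hval : (extendIcc n ∘L restrictIcc n ∘L K - K) f x
      = K f (projIcc (-(n:ℝ)) n (neg_natCast_le n) x) - K f x := rfl
    rw [hval, norm_eq_abs]
    by_cases hx : x ∈ Icc (-(n:ℝ)) n
    · rw [projIcc_of_mem _ hx]
      have := cosh_pos (c * n)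
      simp only [sub_self, abs_zero]
      positivity
    · have hfar : ∀ z : ℝ, (n:ℝ) ≤ |z| → |K f z| ≤ D * ‖f‖ / cosh (c * n) := fun z hz => by
        refine (hK f z).trans ?_
        gcongr
        rw [cosh_le_cosh, abs_mul, abs_mul, Nat.abs_cast]
        gcongr
      have hx1 : (n:ℝ) ≤ |x| := by
        by_contra hlt
        exact hx (abs_le.mp (not_le.mp hlt).le)
      have hx2 : (n:ℝ) ≤ |(projIcc (-(n:ℝ)) n (neg_natCast_le n) x : ℝ)| := by
        rcases le_total x (-(n:ℝ)) with h' | h'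
        · rw [projIcc_of_le_left _ h']; simp
        · have : (n:ℝ) ≤ x := by
            by_contra hlt
            exact hx ⟨h', (not_le.mp hlt).le⟩
          rw [projIcc_of_right_le _ this]; simp
      calc _ ≤ _ := abs_sub _ _
        _ ≤ D * ‖f‖ / cosh (c * n) + D * ‖f‖ / cosh (c * n) := add_le_add (hfar _ hx2) (hfar _ hx1)
        _ = _ := by ring
  · have := ((isCompactOperator_restrictIcc_wConv hm h n).comp_clm
      (ContinuousLinearMap.mul ℝ (ℝ →ᵇ ℝ) p)).clm_comp (extendIcc n)
    exact this

end Weighted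

section Nondegeneracy
open Set Filter Topology

theorem hasDerivAt_tanh_mul (b x : ℝ) :
    HasDerivAt (fun x => tanh (b * x)) (b * (1 - tanh (b * x) ^ 2)) x := by
  have hb : HasDerivAt (fun x : ℝ => b * x) b x := by simpa using (hasDerivAt_id x).const_mul b
  have hc := (cosh_pos (b * x)).ne'
  have h := (hb.sinh.div hb.cosh hc)
  simp only [tanh_eq_sinh_div_cosh]
  refine h.congr_deriv ?_
  field_simp

theorem hasDerivAt_cosh_rpow_neg (s b x : ℝ) :
    HasDerivAt (fun x => cosh (b * x) ^ (-s)) (-(s * b * tanh (b * x)) * cosh (b * x) ^ (-s)) x := by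
  have hb : HasDerivAt (fun x : ℝ => b * x) b x := by simpa using (hasDerivAt_id x).const_mul b
  have hc := cosh_pos (b * x)
  refine (hb.cosh.rpow_const (p := -s) (Or.inl hc.ne')).congr_deriv ?_
  rw [rpow_sub_one hc.ne', tanh_eq_sinh_div_cosh]
  ring

theorem neg_of_hasDerivAt_of_even {f f' : ℝ → ℝ} (h : ∀ x, HasDerivAt f (f' x) x)
    (he : ∀ x, f (-x) = f x) (x : ℝ) : f' (-x) = -f' x := by
  have h1 := (h (-x)).scomp x (hasDerivAt_neg x)
  rw [show f ∘ Neg.neg = f from funext he] at h1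
  have := h1.unique (h x)
  simp only [smul_eq_mul] at this
  linarith

theorem eq_of_hasDerivAt_of_odd {f f' : ℝ → ℝ} (h : ∀ x, HasDerivAt f (f' x) x)
    (he : ∀ x, f (-x) = -f x) (x : ℝ) : f' (-x) = f' x := by
  have h1 := (h (-x)).scomp x (hasDerivAt_neg x)
  rw [show f ∘ Neg.neg = -f from funext he] at h1
  have := h1.unique (h x).neg
  simp only [smul_eq_mul] at this
  linarith

/-- A solution of the linearized equation gives a nondecreasing energy on the half line. -/
theorem hasDerivAt_linearized_energy {s b v₀ : ℝ} (hs : 0 < s) (hb : 0 < b)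
    {t φ v v1 v2 v3 A : ℝ → ℝ} {x : ℝ} (ht : HasDerivAt t (b * (1 - t x ^ 2)) x)
    (hφ : HasDerivAt φ (-(s * b * t x) * φ x) x) (hσ : 0 < 1 - t x ^ 2) (hφ0 : 0 < φ x)
    (h0 : HasDerivAt v (v1 x) x) (h1 : HasDerivAt v1 (v2 x) x) (h2 : HasDerivAt v2 (v3 x) x)
    (h3 : HasDerivAt v3 (((s * b) ^ 2 + ((s + 2) * b) ^ 2) * v2 x
      - (s * b) ^ 2 * ((s + 2) * b) ^ 2 * v x
      + (s + 1) * (s + 2) * (s + 3) * (s + 4) * b ^ 4 * (1 - t x ^ 2) ^ 2 * v x) x)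
    (hA : HasDerivAt A ((v1 x + s * b * t x * v x) ^ 2 / (φ x ^ 2 * (s * b ^ 2 * (1 - t x ^ 2)))) x)
    {G G1 G2 K q : ℝ → ℝ}
    (hG : G = fun x => v1 x + s * b * t x * v x)
    (hG1 : G1 = fun x => v2 x + s * b ^ 2 * (1 - t x ^ 2) * v x + s * b * t x * v1 x)
    (hG2 : G2 = fun x => v3 x - 2 * s * b ^ 3 * t x * (1 - t x ^ 2) * v x
      + 2 * (s * b ^ 2 * (1 - t x ^ 2)) * v1 x + s * b * t x * v2 x)
    (hK : K = fun x => G1 x + s * b * t x * G x)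
    (hq : q = fun x => ((s * b) ^ 2 + ((s + 2) * b) ^ 2 + 4 * (s * b ^ 2 * (1 - t x ^ 2))
      - 2 * (s * b * t x) ^ 2) * G x - (G2 x + s * b ^ 2 * (1 - t x ^ 2) * G x + s * b * t x * G1 x)
      + s * b * t x * K x) :
    HasDerivAt (fun x => K x * G x + 2 * b * t x * G x ^ 2 + q x * v x
        - 2 * s * b ^ 4 * (s + 1) * (s + 3) * (φ x ^ 2 * (1 - t x ^ 2) ^ 2 * A x) - 2 * v₀ * φ x * q x)
      ((K x + 2 * b * t x * G x) ^ 2 + 4 * (s + 1) * (s + 2) * (s + 3) * b ^ 4 * (1 - t x ^ 2) ^ 2 *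
        (s * b * t x * A x * φ x ^ 2 - v x ^ 2 + 2 * v x * v₀ * φ x)) x := by
  have dG : HasDerivAt G (G1 x) x := by
    rw [hG, hG1]
    refine (h1.add ((ht.const_mul (s * b)).mul h0)).congr_deriv ?_
    ring
  have dG1 : HasDerivAt G1 (G2 x) x := by
    rw [hG1, hG2]
    refine ((h2.add ((((ht.pow 2).const_sub 1).const_mul (s * b ^ 2)).mul h0)).add
      ((ht.const_mul (s * b)).mul h1)).congr_deriv ?_
    simp only [Pi.pow_apply]
    push_cast
    ring
  have dK : HasDerivAt K (G2 x + s * b ^ 2 * (1 - t x ^ 2) * G x + s * b * t x * G1 x) x := by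
    rw [hK]
    refine (dG1.add ((ht.const_mul (s * b)).mul dG)).congr_deriv ?_
    ring
  have hσ' : HasDerivAt (fun x => 1 - t x ^ 2) (-(2 * t x * (b * (1 - t x ^ 2)))) x := by
    refine ((ht.pow 2).const_sub 1).congr_deriv ?_
    push_cast; ring
  have dG2 := ((h3.sub (((ht.const_mul (2 * s * b ^ 3)).mul hσ').mul h0)).add
    (((hσ'.const_mul (s * b ^ 2)).const_mul 2).mul h1)).add ((ht.const_mul (s * b)).mul h2)
  have dq : HasDerivAt q (s * b * t x * q x
      - 4 * (s + 1) * (s + 2) * (s + 3) * b ^ 4 * (1 - t x ^ 2) ^ 2 * v x) x := by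
    have d := (((((hσ'.const_mul (s * b ^ 2)).const_mul 4).const_add
      ((s * b) ^ 2 + ((s + 2) * b) ^ 2)).sub (((ht.const_mul (s * b)).pow 2).const_mul 2)).mul dG).sub
        ((dG2.add ((hσ'.const_mul (s * b ^ 2)).mul dG)).add ((ht.const_mul (s * b)).mul dG1)) |>.add
        ((ht.const_mul (s * b)).mul dK)
    rw [hG2] at hq
    rw [hq]
    refine d.congr_deriv ?_
    simp only [hG, hG1, hG2, hK, Pi.mul_apply, Pi.sub_apply, Pi.pow_apply]
    push_cast
    ring
  have dE := ((((dK.mul dG).add ((ht.const_mul (2 * b)).mul (dG.pow 2))).add (dq.mul h0)).sub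
    (((hφ.pow 2).mul (hσ'.pow 2)).mul hA |>.const_mul (2 * s * b ^ 4 * (s + 1) * (s + 3)))).sub
    ((hφ.const_mul (2 * v₀)).mul dq)
  refine dE.congr_deriv ?_
  have hv1 : v1 x + s * b * t x * v x = G x := by rw [hG]
  have hv1' : v1 x = G x - s * b * t x * v x := by rw [hG]; ring
  rw [hv1, hv1']
  simp only [Pi.mul_apply, Pi.pow_apply]
  have e1 : φ x ^ 2 * (1 - t x ^ 2) ^ 2 * (G x ^ 2 / (φ x ^ 2 * (s * b ^ 2 * (1 - t x ^ 2))))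
      = (1 - t x ^ 2) * G x ^ 2 / (s * b ^ 2) := by
    field_simp
  have hG1K : G1 x = K x - s * b * t x * G x := by rw [hK]; ring
  have hq2 : G2 x = ((s * b) ^ 2 + ((s + 2) * b) ^ 2 + 4 * (s * b ^ 2 * (1 - t x ^ 2))
      - 2 * (s * b * t x) ^ 2) * G x - (s * b ^ 2 * (1 - t x ^ 2) * G x + s * b * t x * G1 x)
      + s * b * t x * K x - q x := by rw [hq]; ring
  rw [e1, hq2, hG1K]
  push_cast
  field_simp
  ring

theorem one_sub_tanh_sq_pos (x : ℝ) : 0 < 1 - tanh x ^ 2 := sub_pos.mpr (tanh_sq_lt_one x)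

/-- A pointwise Cauchy–Schwarz inequality: `(w x - w 0)² ≤ h x * ∫₀ˣ w'² / h'`. -/
theorem sq_sub_le_mul_of_hasDerivAt {w w' h h' A : ℝ → ℝ} (hw : ∀ x, HasDerivAt w (w' x) x)
    (hh : ∀ x, HasDerivAt h (h' x) x) (hA : ∀ x, HasDerivAt A (w' x ^ 2 / h' x) x)
    (hpos : ∀ x, 0 < h' x) (h0 : h 0 = 0) (hA0 : A 0 = 0) {x : ℝ} (hx : 0 ≤ x) :
    (w x - w 0) ^ 2 ≤ h x * A x := by
  have hmono : StrictMono h := strictMono_of_hasDerivAt_pos hh hpos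
  rcases hx.eq_or_lt with rfl | hx
  · simp [h0]
  have hhx : 0 < h x := by simpa [h0] using hmono hx
  set κ := (w x - w 0) / h x with hκ
  have hF : ∀ y, HasDerivAt (fun y => A y - 2 * κ * (w y - w 0) + κ ^ 2 * h y)
      (w' y ^ 2 / h' y - 2 * κ * w' y + κ ^ 2 * h' y) y := fun y =>
    ((hA y).sub (((hw y).sub_const (w 0)).const_mul (2 * κ))).add ((hh y).const_mul (κ ^ 2))
  have hF' : Monotone (fun y => A y - 2 * κ * (w y - w 0) + κ ^ 2 * h y) := by
    refine monotone_of_hasDerivAt_nonneg hF fun y => ?_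
    have := hpos y
    have e : w' y ^ 2 / h' y - 2 * κ * w' y + κ ^ 2 * h' y = (w' y - κ * h' y) ^ 2 / h' y := by
      field_simp
      ring
    show 0 ≤ _
    rw [e]
    positivity
  have := hF' hx.le
  simp only [hA0, h0, sub_self, mul_zero, add_zero] at this
  have e : h x * (A x - 2 * κ * (w x - w 0) + κ ^ 2 * h x) = h x * A x - (w x - w 0) ^ 2 := by
    rw [hκ]
    field_simp
    ring
  nlinarith [mul_nonneg hhx.le this]

theorem eq_const_of_hasDerivAt_zero_of_nonneg {f f' : ℝ → ℝ} (h : ∀ x, HasDerivAt f (f' x) x)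
    (h0 : ∀ x, 0 ≤ x → f' x = 0) {x : ℝ} (hx : 0 ≤ x) : f x = f 0 := by
  refine constant_of_has_deriv_right_zero (a := 0) (b := x)
    (fun y _ => (h y).continuousAt.continuousWithinAt) (fun y hy => ?_) x ⟨hx, le_rfl⟩
  have := (h y).hasDerivWithinAt (s := Ici y)
  rwa [h0 y hy.1] at this

theorem tendsto_linearized_energy_bound {s b v₀ : ℝ} {t φ v v1 v2 v3 : ℝ → ℝ}
    (bt : ∀ x, |t x| ≤ 1) (bφ : ∀ x, |φ x| ≤ 1)
    (l0 : Tendsto v atTop (𝓝 0)) (l1 : Tendsto v1 atTop (𝓝 0))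
    (l2 : Tendsto v2 atTop (𝓝 0)) (l3 : Tendsto v3 atTop (𝓝 0))
    {G G1 G2 K q : ℝ → ℝ}
    (hG : G = fun x => v1 x + s * b * t x * v x)
    (hG1 : G1 = fun x => v2 x + s * b ^ 2 * (1 - t x ^ 2) * v x + s * b * t x * v1 x)
    (hG2 : G2 = fun x => v3 x - 2 * s * b ^ 3 * t x * (1 - t x ^ 2) * v x
      + 2 * (s * b ^ 2 * (1 - t x ^ 2)) * v1 x + s * b * t x * v2 x)
    (hK : K = fun x => G1 x + s * b * t x * G x)
    (hq : q = fun x => ((s * b) ^ 2 + ((s + 2) * b) ^ 2 + 4 * (s * b ^ 2 * (1 - t x ^ 2))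
      - 2 * (s * b * t x) ^ 2) * G x - (G2 x + s * b ^ 2 * (1 - t x ^ 2) * G x + s * b * t x * G1 x)
      + s * b * t x * K x) :
    Tendsto (fun x => K x * G x + 2 * b * t x * G x ^ 2 + q x * v x - 2 * v₀ * φ x * q x)
      atTop (𝓝 0) := by
  have bm : ∀ {f g : ℝ → ℝ}, (∀ x, |f x| ≤ 1) → Tendsto g atTop (𝓝 0) →
      Tendsto (fun x => f x * g x) atTop (𝓝 0) := fun {f g} hf hg =>
    (hg.zero_mul_isBoundedUnder_le (isBoundedUnder_of ⟨1, fun x => by simpa using hf x⟩)).congr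
      fun x => mul_comm _ _
  have lt : ∀ {g : ℝ → ℝ}, Tendsto g atTop (𝓝 0) → Tendsto (fun x => t x * g x) atTop (𝓝 0) :=
    fun hg => bm bt hg
  have lσ : ∀ {g : ℝ → ℝ}, Tendsto g atTop (𝓝 0) →
      Tendsto (fun x => (1 - t x ^ 2) * g x) atTop (𝓝 0) := fun hg => by
    have := hg.sub (lt (lt hg))
    rw [sub_zero] at this
    exact this.congr fun x => by ring
  have lG : Tendsto G atTop (𝓝 0) := by
    have := l1.add ((lt l0).const_mul (s * b))
    simp only [mul_zero, add_zero] at this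
    exact this.congr fun x => by rw [hG]; ring
  have lG1 : Tendsto G1 atTop (𝓝 0) := by
    have := (l2.add ((lσ l0).const_mul (s * b ^ 2))).add ((lt l1).const_mul (s * b))
    simp only [mul_zero, add_zero] at this
    exact this.congr fun x => by rw [hG1]; ring
  have lG2 : Tendsto G2 atTop (𝓝 0) := by
    have := ((l3.sub ((lt (lσ l0)).const_mul (2 * s * b ^ 3))).add
      ((lσ l1).const_mul (2 * s * b ^ 2))).add ((lt l2).const_mul (s * b))
    simp only [mul_zero, add_zero, sub_zero] at this
    exact this.congr fun x => by rw [hG2]; ring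
  have lK : Tendsto K atTop (𝓝 0) := by
    have := lG1.add ((lt lG).const_mul (s * b))
    simp only [mul_zero, add_zero] at this
    exact this.congr fun x => by rw [hK]; ring
  have lq : Tendsto q atTop (𝓝 0) := by
    have := ((((lG.const_mul ((s * b) ^ 2 + ((s + 2) * b) ^ 2)).add
      ((lσ lG).const_mul (4 * (s * b ^ 2)))).sub ((lt (lt lG)).const_mul (2 * (s * b) ^ 2))).sub
      ((lG2.add ((lσ lG).const_mul (s * b ^ 2))).add ((lt lG1).const_mul (s * b)))).add
      ((lt lK).const_mul (s * b))
    simp only [mul_zero, add_zero, sub_zero] at this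
    exact this.congr fun x => by rw [hq]; ring
  have lGG : Tendsto (fun x => G x * G x) atTop (𝓝 0) := by simpa using lG.mul lG
  have := (((lK.mul lG).add ((lt lGG).const_mul (2 * b))).add (lq.mul l0)).sub
    ((bm bφ lq).const_mul (2 * v₀))
  simp only [mul_zero, add_zero, sub_zero] at this
  exact this.congr fun x => by ring

theorem eq_zero_of_linearized_first_order {s b : ℝ} {t φ v v1 v2 : ℝ → ℝ}
    (h0 : ∀ x, HasDerivAt v (v1 x) x) (h1 : ∀ x, HasDerivAt v1 (v2 x) x)
    (dt : ∀ x, HasDerivAt t (b * (1 - t x ^ 2)) x)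
    (dφ : ∀ x, HasDerivAt φ (-(s * b * t x) * φ x) x) (hσ : ∀ x, 0 < 1 - t x ^ 2)
    (hφ0 : ∀ x, 0 < φ x) (t0 : t 0 = 0) (v0 : v 0 = 0) (v10 : v1 0 = 0)
    (hKG : ∀ x, 0 ≤ x → v2 x + s * b ^ 2 * (1 - t x ^ 2) * v x + s * b * t x * v1 x
      + s * b * t x * (v1 x + s * b * t x * v x) + 2 * b * t x * (v1 x + s * b * t x * v x) = 0)
    {x : ℝ} (hx : 0 ≤ x) : v x = 0 := by
  have dG : ∀ x, HasDerivAt (fun x => (v1 x + s * b * t x * v x) / (φ x * (1 - t x ^ 2)))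
      ((v2 x + s * b ^ 2 * (1 - t x ^ 2) * v x + s * b * t x * v1 x
      + s * b * t x * (v1 x + s * b * t x * v x) + 2 * b * t x * (v1 x + s * b * t x * v x))
        / (φ x * (1 - t x ^ 2))) x := fun x => by
    have d := ((h1 x).add (((dt x).const_mul (s * b)).mul (h0 x))).div
      ((dφ x).mul (((dt x).pow 2).const_sub 1)) (mul_pos (hφ0 x) (hσ x)).ne'
    refine d.congr_deriv ?_
    have := (hσ x).ne'
    have := (hφ0 x).ne'
    simp only [Pi.mul_apply, Pi.add_apply, Pi.pow_apply]
    push_cast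
    field_simp
    ring
  have Gz : ∀ x, 0 ≤ x → v1 x + s * b * t x * v x = 0 := fun x hx => by
    have := eq_const_of_hasDerivAt_zero_of_nonneg dG (fun y hy => by rw [hKG y hy, zero_div]) hx
    rw [t0, v10, mul_zero, zero_mul, add_zero, zero_div] at this
    exact (div_eq_zero_iff.mp this).resolve_right (mul_pos (hφ0 x) (hσ x)).ne'
  have dw : ∀ x, HasDerivAt (fun x => v x / φ x) ((v1 x + s * b * t x * v x) / φ x) x := fun x => by
    refine ((h0 x).div (dφ x) (hφ0 x).ne').congr_deriv ?_
    have := (hφ0 x).ne'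
    field_simp
    ring
  have := eq_const_of_hasDerivAt_zero_of_nonneg dw (fun y hy => by rw [Gz y hy, zero_div]) hx
  rw [v0, zero_div] at this
  exact (div_eq_zero_iff.mp this).resolve_right (hφ0 x).ne'

/-- The linearized operator has no nontrivial even decaying solutions. -/
theorem even_kernel_trivial {s b : ℝ} (hs : 0 < s) (hb : 0 < b) {v v1 v2 v3 : ℝ → ℝ}
    (h0 : ∀ x, HasDerivAt v (v1 x) x) (h1 : ∀ x, HasDerivAt v1 (v2 x) x)
    (h2 : ∀ x, HasDerivAt v2 (v3 x) x)
    (h3 : ∀ x, HasDerivAt v3 (((s * b) ^ 2 + ((s + 2) * b) ^ 2) * v2 x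
      - (s * b) ^ 2 * ((s + 2) * b) ^ 2 * v x
      + (s + 1) * (s + 2) * (s + 3) * (s + 4) * b ^ 4 * (1 - tanh (b * x) ^ 2) ^ 2 * v x) x)
    (he : ∀ x, v (-x) = v x) (l0 : Tendsto v atTop (𝓝 0)) (l1 : Tendsto v1 atTop (𝓝 0))
    (l2 : Tendsto v2 atTop (𝓝 0)) (l3 : Tendsto v3 atTop (𝓝 0)) : v = 0 := by
  have o1 := neg_of_hasDerivAt_of_even h0 he
  have e2 := eq_of_hasDerivAt_of_odd h1 o1
  have o3 := neg_of_hasDerivAt_of_even h2 e2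
  have z1 : v1 0 = 0 := by have := o1 0; simp only [neg_zero] at this; linarith
  have z3 : v3 0 = 0 := by have := o3 0; simp only [neg_zero] at this; linarith
  set t : ℝ → ℝ := fun x => tanh (b * x) with ht
  set φ : ℝ → ℝ := fun x => cosh (b * x) ^ (-s) with hφ
  have dt : ∀ x, HasDerivAt t (b * (1 - t x ^ 2)) x := hasDerivAt_tanh_mul b
  have dφ : ∀ x, HasDerivAt φ (-(s * b * t x) * φ x) x := hasDerivAt_cosh_rpow_neg s b
  have hσ : ∀ x, 0 < 1 - t x ^ 2 := fun x => one_sub_tanh_sq_pos _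
  have hφ0 : ∀ x, 0 < φ x := fun x => rpow_pos_of_pos (cosh_pos _) _
  have hφ1 : ∀ x, φ x ≤ 1 := fun x => rpow_le_one_of_one_le_of_nonpos (one_le_cosh _) (by linarith)
  have t0 : t 0 = 0 := by simp [ht]
  have φ0 : φ 0 = 1 := by simp [hφ]
  have ct : Continuous t := continuous_iff_continuousAt.mpr fun x => (dt x).continuousAt
  have cφ : Continuous φ := continuous_iff_continuousAt.mpr fun x => (dφ x).continuousAt
  have cv : Continuous v := continuous_iff_continuousAt.mpr fun x => (h0 x).continuousAt
  have cv1 : Continuous v1 := continuous_iff_continuousAt.mpr fun x => (h1 x).continuousAt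
  set a : ℝ → ℝ := fun x => (v1 x + s * b * t x * v x) ^ 2 / (φ x ^ 2 * (s * b ^ 2 * (1 - t x ^ 2)))
    with ha
  have ca : Continuous a := by
    refine Continuous.div (by fun_prop) (by fun_prop) fun x => ?_
    have := hσ x
    have := hφ0 x
    positivity
  set A : ℝ → ℝ := fun x => ∫ y in (0:ℝ)..x, a y with hA
  have dA : ∀ x, HasDerivAt A (a x) x := fun x => (ca.integral_hasStrictDerivAt 0 x).hasDerivAt
  have A0 : A 0 = 0 := by simp [hA]
  have dw : ∀ x, HasDerivAt (fun x => v x / φ x) ((v1 x + s * b * t x * v x) / φ x) x := fun x => by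
    refine ((h0 x).div (dφ x) (hφ0 x).ne').congr_deriv ?_
    have := (hφ0 x).ne'
    field_simp
    ring
  have cs : ∀ x, 0 ≤ x → (v x / φ x - v 0) ^ 2 ≤ s * b * t x * A x := fun x hx => by
    have dh : ∀ x, HasDerivAt (fun x => s * b * t x) (s * b ^ 2 * (1 - t x ^ 2)) x := fun x => by
      refine ((dt x).const_mul (s * b)).congr_deriv ?_
      ring
    have := sq_sub_le_mul_of_hasDerivAt (A := A) dw dh (fun x => by
      refine (dA x).congr_deriv ?_
      have := (hσ x).ne'
      have := (hφ0 x).ne'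
      simp only [ha]
      field_simp) (fun x => by have := hσ x; positivity) (by simp [t0]) A0 hx
    simpa [φ0] using this
  set G : ℝ → ℝ := fun x => v1 x + s * b * t x * v x with hG
  set G1 : ℝ → ℝ := fun x => v2 x + s * b ^ 2 * (1 - t x ^ 2) * v x + s * b * t x * v1 x with hG1
  set G2 : ℝ → ℝ := fun x => v3 x - 2 * s * b ^ 3 * t x * (1 - t x ^ 2) * v x
      + 2 * (s * b ^ 2 * (1 - t x ^ 2)) * v1 x + s * b * t x * v2 x with hG2
  set K : ℝ → ℝ := fun x => G1 x + s * b * t x * G x with hK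
  set q : ℝ → ℝ := fun x => ((s * b) ^ 2 + ((s + 2) * b) ^ 2 + 4 * (s * b ^ 2 * (1 - t x ^ 2))
      - 2 * (s * b * t x) ^ 2) * G x - (G2 x + s * b ^ 2 * (1 - t x ^ 2) * G x + s * b * t x * G1 x)
      + s * b * t x * K x with hq
  have dE := fun x => hasDerivAt_linearized_energy (v₀ := v 0) hs hb (dt x) (dφ x) (hσ x) (hφ0 x)
    (h0 x) (h1 x) (h2 x) (h3 x) (dA x) hG hG1 hG2 hK hq
  set E : ℝ → ℝ := fun x => K x * G x + 2 * b * t x * G x ^ 2 + q x * v x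
        - 2 * s * b ^ 4 * (s + 1) * (s + 3) * (φ x ^ 2 * (1 - t x ^ 2) ^ 2 * A x)
        - 2 * v 0 * φ x * q x with hE
  set R : ℝ → ℝ := fun x => K x * G x + 2 * b * t x * G x ^ 2 + q x * v x - 2 * v 0 * φ x * q x with hR
  have key : ∀ x, 0 ≤ x → φ x ^ 2 * v 0 ^ 2 ≤
      s * b * t x * A x * φ x ^ 2 - v x ^ 2 + 2 * v x * v 0 * φ x := fun x hx => by
    have h := mul_le_mul_of_nonneg_right (cs x hx) (sq_nonneg (φ x))
    have e : (v x / φ x - v 0) ^ 2 * φ x ^ 2 = (v x - v 0 * φ x) ^ 2 := by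
      have := (hφ0 x).ne'
      field_simp
    rw [e] at h
    nlinarith
  have hc : 0 < 4 * (s + 1) * (s + 2) * (s + 3) * b ^ 4 := by positivity
  have hE' : ∀ x, 0 ≤ x → 0 ≤ 4 * (s + 1) * (s + 2) * (s + 3) * b ^ 4 * (1 - t x ^ 2) ^ 2 *
      (s * b * t x * A x * φ x ^ 2 - v x ^ 2 + 2 * v x * v 0 * φ x) := fun x hx =>
    mul_nonneg (mul_nonneg hc.le (sq_nonneg _)) (le_trans (by positivity) (key x hx))
  have mono : MonotoneOn E (Ici 0) := by
    refine monotoneOn_of_hasDerivWithinAt_nonneg (convex_Ici 0)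
      (fun x _ => (dE x).continuousAt.continuousWithinAt) (fun x _ => (dE x).hasDerivWithinAt)
      fun x hx => ?_
    rw [interior_Ici] at hx
    exact add_nonneg (sq_nonneg _) (hE' x (le_of_lt hx))
  have E0 : E 0 = 0 := by
    simp [hE, hG, hG1, hG2, hK, hq, t0, A0, z1, z3]
  have lR : Tendsto R atTop (𝓝 0) := tendsto_linearized_energy_bound
    (fun x => (abs_tanh_lt_one _).le) (fun x => by rw [abs_of_pos (hφ0 x)]; exact hφ1 x)
    l0 l1 l2 l3 hG hG1 hG2 hK hq
  have A_nonneg : ∀ x, 0 ≤ x → 0 ≤ A x := fun x hx =>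
    intervalIntegral.integral_nonneg hx fun y _ => by
      have := hσ y
      positivity
  have ER : ∀ x, 0 ≤ x → E x ≤ R x := fun x hx => by
    have := A_nonneg x hx
    have : 0 ≤ 2 * s * b ^ 4 * (s + 1) * (s + 3) * (φ x ^ 2 * (1 - t x ^ 2) ^ 2 * A x) := by positivity
    simp only [hE, hR]
    linarith
  have Ez : ∀ x, 0 ≤ x → E x = 0 := fun x hx => by
    refine le_antisymm (ge_of_tendsto lR ?_) (E0 ▸ mono self_mem_Ici hx hx)
    filter_upwards [eventually_ge_atTop x] with y hy
    exact (mono hx (hx.trans hy) hy).trans (ER y (hx.trans hy))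
  have dz : ∀ x, 0 ≤ x → (K x + 2 * b * t x * G x) ^ 2 + 4 * (s + 1) * (s + 2) * (s + 3) * b ^ 4 *
      (1 - t x ^ 2) ^ 2 * (s * b * t x * A x * φ x ^ 2 - v x ^ 2 + 2 * v x * v 0 * φ x) = 0 :=
    fun x hx => by
      have e := (dE x).hasDerivWithinAt (s := Ici 0)
      have e' : HasDerivWithinAt E 0 (Ici 0) x :=
        (hasDerivWithinAt_const x (Ici (0:ℝ)) (0:ℝ)).congr (fun y hy => Ez y hy) (Ez x hx)
      exact (uniqueDiffOn_Ici (0:ℝ) x hx).eq_deriv _ e e'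
  have v00 : v 0 = 0 := by
    have d0 := dz 0 le_rfl
    have k0 := key 0 le_rfl
    rw [φ0, t0, A0] at k0
    rw [t0, A0, φ0] at d0
    have h5 := mul_nonneg hc.le (sq_nonneg (v 0))
    have h6 : 4 * (s + 1) * (s + 2) * (s + 3) * b ^ 4 * v 0 ^ 2 = 0 := by
      linarith [sq_nonneg (K 0 + 2 * b * 0 * G 0)]
    simpa [hc.ne'] using h6
  have KG : ∀ x, 0 ≤ x → K x + 2 * b * t x * G x = 0 := fun x hx => by
    have h6 : (K x + 2 * b * t x * G x) ^ 2 = 0 :=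
      le_antisymm (by linarith [dz x hx, hE' x hx]) (sq_nonneg _)
    exact pow_eq_zero_iff two_ne_zero |>.mp h6
  have vz : ∀ x, 0 ≤ x → v x = 0 := fun x hx =>
    eq_zero_of_linearized_first_order h0 h1 dt dφ hσ hφ0 t0 v00 z1 KG hx
  funext x
  rcases le_total 0 x with hx | hx
  · exact vz x hx
  · rw [← he x]
    exact vz (-x) (by linarith)

end Nondegeneracy

section SolutionOperator
open Set Filter Topology BoundedContinuousFunction

theorem continuous_of_hasDerivAt {u u' : ℝ → ℝ} (h : ∀ x, HasDerivAt u (u' x) x) : Continuous u :=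
  continuous_iff_continuousAt.mpr fun x => (h x).continuousAt

theorem hasDerivAt_comp_neg {u u' : ℝ → ℝ} (h : ∀ x, HasDerivAt u (u' x) x) (x : ℝ) :
    HasDerivAt (fun x => u (-x)) (-u' (-x)) x := by
  have h1 := (h (-x)).scomp x (hasDerivAt_neg x)
  simpa [Function.comp_def] using h1

/-- Bounded solutions of `(∂² - a₁²)(∂² - a₂²) u = F` are obtained by four first order solves. -/
theorem exists_expConv_representation {a₁ a₂ C D : ℝ} (ha₁ : 0 < a₁) (ha₂ : 0 < a₂)
    {F u u1 u2 u3 : ℝ → ℝ} (hF : Continuous F) (hFC : ∀ x, |F x| ≤ C)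
    (h0 : ∀ x, HasDerivAt u (u1 x) x) (h1 : ∀ x, HasDerivAt u1 (u2 x) x)
    (h2 : ∀ x, HasDerivAt u2 (u3 x) x)
    (h3 : ∀ x, HasDerivAt u3 ((a₁ ^ 2 + a₂ ^ 2) * u2 x - a₁ ^ 2 * a₂ ^ 2 * u x + F x) x)
    (b0 : ∀ x, |u x| ≤ D) (b1 : ∀ x, |u1 x| ≤ D) (b2 : ∀ x, |u2 x| ≤ D) (b3 : ∀ x, |u3 x| ≤ D) :
    ∃ y1 y2 y3 : ℝ → ℝ, ∃ B : ℝ, Continuous y1 ∧ Continuous y2 ∧ Continuous y3 ∧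
      (∀ x, |y1 x| ≤ B) ∧ (∀ x, |y2 x| ≤ B) ∧ (∀ x, |y3 x| ≤ B) ∧
      (fun x => y1 (-x)) = expConv a₁ (fun x => F (-x)) ∧ y2 = expConv a₁ y1 ∧
      (fun x => y3 (-x)) = expConv a₂ (fun x => y2 (-x)) ∧ u = expConv a₂ y3 := by
  have c0 := continuous_of_hasDerivAt h0
  have c1 := continuous_of_hasDerivAt h1
  have c2 := continuous_of_hasDerivAt h2
  have c3 := continuous_of_hasDerivAt h3
  set y3 : ℝ → ℝ := fun x => u1 x + a₂ * u x with hy3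
  set y2 : ℝ → ℝ := fun x => a₂ ^ 2 * u x - u2 x with hy2
  set y1 : ℝ → ℝ := fun x => a₂ ^ 2 * u1 x - u3 x + a₁ * y2 x with hy1
  have cy2 : Continuous y2 := by fun_prop
  have cy1 : Continuous y1 := by fun_prop
  have cy3 : Continuous y3 := by fun_prop
  have d3 : ∀ x, HasDerivAt y3 (a₂ * y3 x - y2 x) x := fun x =>
    ((h1 x).add ((h0 x).const_mul a₂)).congr_deriv (by simp only [hy3, hy2]; ring)
  have d2 : ∀ x, HasDerivAt y2 (y1 x - a₁ * y2 x) x := fun x =>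
    (((h0 x).const_mul (a₂ ^ 2)).sub (h2 x)).congr_deriv (by simp only [hy1, hy2]; ring)
  have d1 : ∀ x, HasDerivAt y1 (a₁ * y1 x - F x) x := fun x =>
    ((((h1 x).const_mul (a₂ ^ 2)).sub (h3 x)).add ((d2 x).const_mul a₁)).congr_deriv
      (by simp only [hy1, hy2]; ring)
  have D0 : 0 ≤ D := (abs_nonneg _).trans (b0 0)
  have B3 : ∀ x, |y3 x| ≤ D + a₂ * D := fun x => (abs_add_le _ _).trans (by
    rw [abs_mul, abs_of_pos ha₂]
    gcongr
    exacts [b1 x, b0 x])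
  have B2 : ∀ x, |y2 x| ≤ a₂ ^ 2 * D + D := fun x => (abs_sub _ _).trans (by
    rw [abs_mul, abs_of_pos (pow_pos ha₂ 2)]
    gcongr
    exacts [b0 x, b2 x])
  have B1 : ∀ x, |y1 x| ≤ a₂ ^ 2 * D + D + a₁ * (a₂ ^ 2 * D + D) := fun x =>
    (abs_add_le _ _).trans (by
      gcongr
      · refine (abs_sub _ _).trans ?_
        rw [abs_mul, abs_of_pos (pow_pos ha₂ 2)]
        gcongr
        exacts [b1 x, b3 x]
      · rw [abs_mul, abs_of_pos ha₁]
        gcongr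
        exact B2 x)
  refine ⟨y1, y2, y3, max (D + a₂ * D) (max (a₂ ^ 2 * D + D) (a₂ ^ 2 * D + D + a₁ * (a₂ ^ 2 * D + D))),
    cy1, cy2, cy3, fun x => (B1 x).trans (by simp), fun x => (B2 x).trans (by simp),
    fun x => (B3 x).trans (by simp), ?_, ?_, ?_, ?_⟩
  · exact eq_expConv_of_hasDerivAt ha₁ (by fun_prop) (fun x => hFC (-x))
      (fun x => (hasDerivAt_comp_neg d1 x).congr_deriv (by ring)) (fun x => B1 (-x))
  · exact eq_expConv_of_hasDerivAt ha₁ cy1 B1 d2 B2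
  · exact eq_expConv_of_hasDerivAt ha₂ (by fun_prop) (fun x => B2 (-x))
      (fun x => (hasDerivAt_comp_neg d3 x).congr_deriv (by ring)) (fun x => B3 (-x))
  · exact eq_expConv_of_hasDerivAt ha₂ cy3 B3 (fun x => (h0 x).congr_deriv (by
      simp only [hy3]; ring)) b0

/-- The weighted solution operator of `(∂² - a₁²)(∂² - a₂²) u = F`. -/
noncomputable def solOp (a₁ a₂ m : ℝ) (hm : 0 ≤ m) (h₁ : m < a₁) (h₂ : m < a₂) :
    (ℝ →ᵇ ℝ) →L[ℝ] (ℝ →ᵇ ℝ) :=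
  wConv a₂ m hm h₂ ∘L wConvRefl a₂ m hm h₂ ∘L wConv a₁ m hm h₁ ∘L wConvRefl a₁ m hm h₁

theorem wConvRefl_div_cosh {a m : ℝ} (hm : 0 ≤ m) (h : m < a) (f : ℝ →ᵇ ℝ) :
    (fun x => wConvRefl a m hm h f (-x) / cosh (m * (-x))) =
      expConv a (fun y => f (-y) / cosh (m * (-y))) := by
  have := wConv_div_cosh hm h (reflectBCF f)
  simpa [wConvRefl, cosh_neg] using this

theorem exists_solOp_chain (a₁ a₂ m : ℝ) (hm : 0 ≤ m) (h₁ : m < a₁) (h₂ : m < a₂) :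
    ∃ D1 D2 D3 : (ℝ →ᵇ ℝ) →L[ℝ] (ℝ →ᵇ ℝ), ∀ F : ℝ →ᵇ ℝ,
      (∀ x, HasDerivAt (fun x => solOp a₁ a₂ m hm h₁ h₂ F x / cosh (m * x))
        (D1 F x / cosh (m * x)) x) ∧
      (∀ x, HasDerivAt (fun x => D1 F x / cosh (m * x)) (D2 F x / cosh (m * x)) x) ∧
      (∀ x, HasDerivAt (fun x => D2 F x / cosh (m * x)) (D3 F x / cosh (m * x)) x) ∧
      (∀ x, HasDerivAt (fun x => D3 F x / cosh (m * x)) ((a₁ ^ 2 + a₂ ^ 2) * (D2 F x / cosh (m * x))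
        - a₁ ^ 2 * a₂ ^ 2 * (solOp a₁ a₂ m hm h₁ h₂ F x / cosh (m * x)) + F x / cosh (m * x)) x) := by
  set Y1 := wConvRefl a₁ m hm h₁ with hY1
  set Y2 := wConv a₁ m hm h₁ ∘L Y1 with hY2
  set Y3 := wConvRefl a₂ m hm h₂ ∘L Y2 with hY3
  set U := wConv a₂ m hm h₂ ∘L Y3 with hU
  have e : solOp a₁ a₂ m hm h₁ h₂ = U := rfl
  rw [e]
  refine ⟨Y3 - a₂ • U, a₂ ^ 2 • U - Y2, a₂ ^ 2 • (Y3 - a₂ • U) - Y1 + a₁ • Y2, fun F => ?_⟩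
  have d1 := hasDerivAt_wConvRefl_div_cosh hm h₁ F
  have d2 := hasDerivAt_wConv_div_cosh hm h₁ (Y1 F)
  have d3 := hasDerivAt_wConvRefl_div_cosh hm h₂ (Y2 F)
  have d4 := hasDerivAt_wConv_div_cosh hm h₂ (Y3 F)
  change ∀ x, HasDerivAt (fun x => Y1 F x / cosh (m * x)) (a₁ * (Y1 F x / cosh (m * x)) - F x / cosh (m * x)) x at d1
  change ∀ x, HasDerivAt (fun x => Y2 F x / cosh (m * x)) (Y1 F x / cosh (m * x) - a₁ * (Y2 F x / cosh (m * x))) x at d2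
  change ∀ x, HasDerivAt (fun x => Y3 F x / cosh (m * x)) (a₂ * (Y3 F x / cosh (m * x)) - Y2 F x / cosh (m * x)) x at d3
  change ∀ x, HasDerivAt (fun x => U F x / cosh (m * x)) (Y3 F x / cosh (m * x) - a₂ * (U F x / cosh (m * x))) x at d4
  simp only [_root_.add_apply, _root_.sub_apply,
    _root_.smul_apply, BoundedContinuousFunction.coe_add,
    BoundedContinuousFunction.coe_sub, BoundedContinuousFunction.coe_smul, Pi.add_apply, Pi.sub_apply,
    smul_eq_mul, add_div, sub_div, mul_div_assoc]
  refine ⟨d4, fun x => ?_, fun x => ?_, fun x => ?_⟩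
  · refine ((d3 x).sub ((d4 x).const_mul a₂)).congr_deriv ?_
    ring
  · refine (((d4 x).const_mul (a₂ ^ 2)).sub (d2 x)).congr_deriv ?_
    ring
  · refine (((((d3 x).sub ((d4 x).const_mul a₂)).const_mul (a₂ ^ 2)).sub (d1 x)).add
      ((d2 x).const_mul a₁)).congr_deriv ?_
    ring

/-- Bounded solutions are given by the solution operator. -/
theorem eq_solOp_of_hasDerivAt {a₁ a₂ m D : ℝ} (hm : 0 ≤ m) (h₁ : m < a₁) (h₂ : m < a₂) (F : ℝ →ᵇ ℝ)
    {u u1 u2 u3 : ℝ → ℝ}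
    (d0 : ∀ x, HasDerivAt u (u1 x) x) (d1 : ∀ x, HasDerivAt u1 (u2 x) x)
    (d2 : ∀ x, HasDerivAt u2 (u3 x) x)
    (d3 : ∀ x, HasDerivAt u3 ((a₁ ^ 2 + a₂ ^ 2) * u2 x - a₁ ^ 2 * a₂ ^ 2 * u x
      + F x / cosh (m * x)) x)
    (b0 : ∀ x, |u x| ≤ D) (b1 : ∀ x, |u1 x| ≤ D) (b2 : ∀ x, |u2 x| ≤ D) (b3 : ∀ x, |u3 x| ≤ D)
    (x : ℝ) : u x = solOp a₁ a₂ m hm h₁ h₂ F x / cosh (m * x) := by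
  obtain ⟨y1, y2, y3, B, -, -, -, -, -, -, e1, e2, e3, e4⟩ := exists_expConv_representation
    (hm.trans_lt h₁) (hm.trans_lt h₂) (continuous_div_cosh m F) (abs_div_cosh_le_norm m F)
    d0 d1 d2 d3 b0 b1 b2 b3
  set Y1 := wConvRefl a₁ m hm h₁ F with hY1
  set Y2 := wConv a₁ m hm h₁ Y1 with hY2
  set Y3 := wConvRefl a₂ m hm h₂ Y2 with hY3
  have f1 : y1 = fun x => Y1 x / cosh (m * x) := by
    funext x
    have := congrFun (e1.trans (wConvRefl_div_cosh hm h₁ F).symm) (-x)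
    simpa using this
  have f2 : y2 = fun x => Y2 x / cosh (m * x) := by
    rw [e2, f1, hY2, wConv_div_cosh]
  have f3 : y3 = fun x => Y3 x / cosh (m * x) := by
    funext x
    rw [f2] at e3
    have := congrFun (e3.trans (wConvRefl_div_cosh hm h₂ Y2).symm) (-x)
    simpa using this
  rw [e4, f3, ← wConv_div_cosh hm h₂]
  rfl

/-- A quantitative maximum principle. -/
theorem neg_le_of_hasDerivAt {a₁ a₂ C D M : ℝ} (ha₁ : 0 < a₁) (ha₂ : 0 < a₂)
    {F u u1 u2 u3 : ℝ → ℝ} (hF : Continuous F) (hFC : ∀ x, |F x| ≤ C)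
    (h0 : ∀ x, HasDerivAt u (u1 x) x) (h1 : ∀ x, HasDerivAt u1 (u2 x) x)
    (h2 : ∀ x, HasDerivAt u2 (u3 x) x)
    (h3 : ∀ x, HasDerivAt u3 ((a₁ ^ 2 + a₂ ^ 2) * u2 x - a₁ ^ 2 * a₂ ^ 2 * u x + F x) x)
    (b0 : ∀ x, |u x| ≤ D) (b1 : ∀ x, |u1 x| ≤ D) (b2 : ∀ x, |u2 x| ≤ D) (b3 : ∀ x, |u3 x| ≤ D)
    (hM : ∀ x, -M ≤ F x) (x : ℝ) : -(M / (a₁ ^ 2 * a₂ ^ 2)) ≤ u x := by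
  obtain ⟨y1, y2, y3, B, c1, c2, c3, B1, B2, B3, e1, e2, e3, e4⟩ := exists_expConv_representation
    ha₁ ha₂ hF hFC h0 h1 h2 h3 b0 b1 b2 b3
  have m1 : ∀ x, -(M / a₁) ≤ y1 x := fun x => by
    have := neg_le_expConv ha₁ (F := fun x => F (-x)) (by fun_prop) (fun x => hFC (-x))
      (fun x => hM (-x)) (-x)
    rw [← e1] at this
    simpa using this
  have m2 : ∀ x, -(M / a₁ / a₁) ≤ y2 x := fun x => by
    rw [e2]
    exact neg_le_expConv ha₁ c1 B1 m1 x
  have m3 : ∀ x, -(M / a₁ / a₁ / a₂) ≤ y3 x := fun x => by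
    have := neg_le_expConv ha₂ (F := fun x => y2 (-x)) (by fun_prop) (fun x => B2 (-x))
      (fun x => m2 (-x)) (-x)
    rw [← e3] at this
    simpa using this
  have m4 := neg_le_expConv ha₂ c3 B3 m3 x
  rw [e4]
  refine le_trans (le_of_eq ?_) m4
  field_simp

theorem pos_of_hasDerivAt {a₁ a₂ C D : ℝ} (ha₁ : 0 < a₁) (ha₂ : 0 < a₂)
    {F u u1 u2 u3 : ℝ → ℝ} (hF : Continuous F) (hFC : ∀ x, |F x| ≤ C)
    (h0 : ∀ x, HasDerivAt u (u1 x) x) (h1 : ∀ x, HasDerivAt u1 (u2 x) x)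
    (h2 : ∀ x, HasDerivAt u2 (u3 x) x)
    (h3 : ∀ x, HasDerivAt u3 ((a₁ ^ 2 + a₂ ^ 2) * u2 x - a₁ ^ 2 * a₂ ^ 2 * u x + F x) x)
    (b0 : ∀ x, |u x| ≤ D) (b1 : ∀ x, |u1 x| ≤ D) (b2 : ∀ x, |u2 x| ≤ D) (b3 : ∀ x, |u3 x| ≤ D)
    (hF0 : ∀ x, 0 ≤ F x) {x₀ : ℝ} (hx₀ : 0 < F x₀) (x : ℝ) : 0 < u x := by
  obtain ⟨y1, y2, y3, B, c1, c2, c3, B1, B2, B3, e1, e2, e3, e4⟩ := exists_expConv_representation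
    ha₁ ha₂ hF hFC h0 h1 h2 h3 b0 b1 b2 b3
  have n1 : ∀ x, 0 ≤ y1 x := fun x => by
    have := expConv_nonneg ha₁ (F := fun x => F (-x)) (by fun_prop) (fun x => hFC (-x))
      (fun x => hF0 (-x)) (-x)
    rw [← e1] at this
    simpa using this
  have p1 : ∀ x, x < x₀ → 0 < y1 x := fun x hx => by
    have := expConv_pos ha₁ (F := fun x => F (-x)) (by fun_prop) (fun x => hFC (-x))
      (fun x => hF0 (-x)) (x := -x) (x₀ := -x₀) (by linarith) (by simpa using hx₀)
    rw [← e1] at this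
    simpa using this
  have p2 : ∀ x, 0 < y2 x := fun x => by
    rw [e2]
    exact expConv_pos ha₁ c1 B1 n1 (x₀ := min x x₀ - 1) (by linarith [min_le_left x x₀])
      (p1 _ (by linarith [min_le_right x x₀]))
  have p3 : ∀ x, 0 < y3 x := fun x => by
    have := expConv_pos ha₂ (F := fun x => y2 (-x)) (by fun_prop) (fun x => B2 (-x))
      (fun x => (p2 (-x)).le) (x := -x) (x₀ := -x - 1) (by linarith) (p2 _)
    rw [← e3] at this
    simpa using this
  rw [e4]
  exact expConv_pos ha₂ c3 B3 (fun x => (p3 x).le) (x₀ := x - 1) (by linarith) (p3 _)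

end SolutionOperator

section Invertibility
open Set Filter Topology BoundedContinuousFunction

theorem tendsto_div_cosh_atTop {m : ℝ} (hm : 0 < m) (f : ℝ →ᵇ ℝ) :
    Tendsto (fun x => f x / cosh (m * x)) atTop (𝓝 0) := by
  have h1 : Tendsto (fun x : ℝ => cosh (m * x)) atTop atTop := by
    refine tendsto_atTop_mono (fun x => ?_)
      ((tendsto_exp_atTop.comp (tendsto_id.const_mul_atTop hm)).atTop_div_const two_pos)
    rw [cosh_eq]
    simp only [Function.comp_apply, id]
    linarith [exp_pos (-(m * x))]
  refine squeeze_zero_norm (fun x => abs_div_cosh_le m f x) ?_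
  exact h1.const_div_atTop _

theorem solOp_div_cosh_congr {a₁ a₂ m κ : ℝ} (hm : 0 ≤ m) (h₁ : m < a₁) (h₂ : m < a₂) (hκ : 0 ≤ κ)
    (k₁ : κ < a₁) (k₂ : κ < a₂) {F G : ℝ →ᵇ ℝ} (h : ∀ x, F x / cosh (m * x) = G x / cosh (κ * x))
    (x : ℝ) : solOp a₁ a₂ m hm h₁ h₂ F x / cosh (m * x) = solOp a₁ a₂ κ hκ k₁ k₂ G x / cosh (κ * x) := by
  obtain ⟨D1, D2, D3, hD⟩ := exists_solOp_chain a₁ a₂ m hm h₁ h₂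
  obtain ⟨d0, d1, d2, d3⟩ := hD F
  refine eq_solOp_of_hasDerivAt (D := ‖solOp a₁ a₂ m hm h₁ h₂ F‖ + ‖D1 F‖ + ‖D2 F‖ + ‖D3 F‖)
    hκ k₁ k₂ G d0 d1 d2 (by simpa only [h] using d3) (fun x => ?_) (fun x => ?_) (fun x => ?_)
    (fun x => ?_) x <;>
  · refine (abs_div_cosh_le_norm m _ x).trans ?_
    linarith [norm_nonneg (solOp a₁ a₂ m hm h₁ h₂ F), norm_nonneg (D1 F), norm_nonneg (D2 F),
      norm_nonneg (D3 F)]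

theorem solOp_even {a₁ a₂ m : ℝ} (hm : 0 ≤ m) (h₁ : m < a₁) (h₂ : m < a₂) {F : ℝ →ᵇ ℝ}
    (hF : ∀ x, F (-x) = F x) (x : ℝ) :
    solOp a₁ a₂ m hm h₁ h₂ F (-x) = solOp a₁ a₂ m hm h₁ h₂ F x := by
  obtain ⟨D1, D2, D3, hD⟩ := exists_solOp_chain a₁ a₂ m hm h₁ h₂
  obtain ⟨d0, d1, d2, d3⟩ := hD F
  have e0 := hasDerivAt_comp_neg d0
  have e1 := fun x => (hasDerivAt_comp_neg d1 x).neg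
  have e2 := hasDerivAt_comp_neg d2
  have e3 := fun x => (hasDerivAt_comp_neg d3 x).neg
  simp only [neg_neg] at e1 e3
  have := eq_solOp_of_hasDerivAt (D := ‖solOp a₁ a₂ m hm h₁ h₂ F‖ + ‖D1 F‖ + ‖D2 F‖ + ‖D3 F‖)
    hm h₁ h₂ F e0 e1 e2 (fun x => (e3 x).congr_deriv (by simp only [hF, mul_neg, cosh_neg]))
    (fun x => ?_) (fun x => ?_) (fun x => ?_) (fun x => ?_) x
  · simp only [mul_neg, cosh_neg] at this
    exact (div_left_inj' (cosh_pos _).ne').mp this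
  all_goals
    try rw [abs_neg]
    refine (abs_div_cosh_le_norm m _ (-x)).trans ?_
    linarith [norm_nonneg (solOp a₁ a₂ m hm h₁ h₂ F), norm_nonneg (D1 F), norm_nonneg (D2 F),
      norm_nonneg (D3 F)]

/-- The projection onto even functions. -/
noncomputable def evenProj : (ℝ →ᵇ ℝ) →L[ℝ] (ℝ →ᵇ ℝ) :=
  (1 / 2 : ℝ) • (ContinuousLinearMap.id ℝ (ℝ →ᵇ ℝ) + reflectBCF)

@[simp] theorem evenProj_apply (f : ℝ →ᵇ ℝ) (x : ℝ) : evenProj f x = (f x + f (-x)) / 2 := by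
  simp [evenProj]
  ring

theorem evenProj_of_even {f : ℝ →ᵇ ℝ} (hf : ∀ x, f (-x) = f x) : evenProj f = f := by
  ext x
  rw [evenProj_apply, hf]
  ring

theorem evenProj_neg (f : ℝ →ᵇ ℝ) (x : ℝ) : evenProj f (-x) = evenProj f x := by
  simp [add_comm]

theorem norm_evenProj_le (f : ℝ →ᵇ ℝ) : ‖evenProj f‖ ≤ ‖f‖ := by
  refine (BoundedContinuousFunction.norm_le (norm_nonneg _)).mpr fun x => ?_
  rw [evenProj_apply, norm_div, norm_two]
  have := norm_add_le (f x) (f (-x))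
  linarith [f.norm_coe_le_norm x, f.norm_coe_le_norm (-x)]

theorem isCompactOperator_solOp_mul {a₁ a₂ m c C : ℝ} (hm : 0 ≤ m) (h₁ : m < a₁) (h₂ : m < a₂)
    (hc : 0 < c) {p : ℝ →ᵇ ℝ} (hp : ∀ y, |p y| ≤ C / cosh (c * y)) (hpe : ∀ x, p (-x) = p x) :
    IsCompactOperator (solOp a₁ a₂ m hm h₁ h₂ ∘L ContinuousLinearMap.mul ℝ (ℝ →ᵇ ℝ) p ∘L evenProj) := by
  have e : solOp a₁ a₂ m hm h₁ h₂ ∘L ContinuousLinearMap.mul ℝ (ℝ →ᵇ ℝ) p ∘L evenProj =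
      (wConv a₂ m hm h₂ ∘L wConvRefl a₂ m hm h₂ ∘L wConv a₁ m hm h₁ ∘L reflectBCF) ∘L
      (wConv a₁ m hm h₁ ∘L ContinuousLinearMap.mul ℝ (ℝ →ᵇ ℝ) p) ∘L evenProj := by
    ext1 f
    have : reflectBCF (p * evenProj f) = p * evenProj f := by
      ext x
      simp [hpe, add_comm]
    simp only [solOp, wConvRefl, ContinuousLinearMap.comp_apply, ContinuousLinearMap.mul_apply', this]
  rw [e]
  exact ((isCompactOperator_wConv_mul hm h₁ hc hp).comp_clm evenProj).clm_comp
    (wConv a₂ m hm h₂ ∘L wConvRefl a₂ m hm h₂ ∘L wConv a₁ m hm h₁ ∘L reflectBCF)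

theorem continuous_tanh_mul (b : ℝ) : Continuous fun x => tanh (b * x) :=
  continuous_of_hasDerivAt (hasDerivAt_tanh_mul b)

/-- The linearized potential `(α + 1) φ ^ α`. -/
noncomputable def linPot (s b : ℝ) : ℝ →ᵇ ℝ :=
  BoundedContinuousFunction.ofNormedAddCommGroup
    (fun x => (s + 1) * (s + 2) * (s + 3) * (s + 4) * b ^ 4 * (1 - tanh (b * x) ^ 2) ^ 2)
    (by
      have := continuous_tanh_mul b
      fun_prop)
    |(s + 1) * (s + 2) * (s + 3) * (s + 4) * b ^ 4| (fun x => by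
      rw [norm_mul, norm_eq_abs, norm_of_nonneg (sq_nonneg (1 - tanh (b * x) ^ 2))]
      refine mul_le_of_le_one_right (abs_nonneg _) (pow_le_one₀ (one_sub_tanh_sq_pos _).le ?_)
      linarith [sq_nonneg (tanh (b * x))])

theorem linPot_apply (s b x : ℝ) : linPot s b x =
    (s + 1) * (s + 2) * (s + 3) * (s + 4) * b ^ 4 * (1 - tanh (b * x) ^ 2) ^ 2 := rfl

theorem one_sub_tanh_sq (x : ℝ) : 1 - tanh x ^ 2 = 1 / cosh x ^ 2 := by
  have := (cosh_pos x).ne'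
  rw [tanh_eq_sinh_div_cosh]
  field_simp
  linarith [cosh_sq x]

theorem abs_linPot_le {s b : ℝ} (hs : 0 < s) (hb : 0 < b) (x : ℝ) :
    |linPot s b x| ≤ (s + 1) * (s + 2) * (s + 3) * (s + 4) * b ^ 4 / cosh (b * x) := by
  have h1 := one_le_cosh (b * x)
  have h2 : 1 / cosh (b * x) ≤ 1 := by
    rw [div_le_one (cosh_pos _)]
    exact h1
  rw [linPot_apply, abs_of_nonneg (by positivity), div_eq_mul_one_div, one_sub_tanh_sq]
  gcongr
  rw [← one_div_pow, ← pow_mul]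
  exact pow_le_of_le_one (by positivity) h2 (by norm_num)

theorem linPot_neg (s b x : ℝ) : linPot s b (-x) = linPot s b x := by
  simp [linPot_apply, tanh_neg]

/-- The integral form of the linearized operator, composed with the projection on even functions. -/
noncomputable def linT (s b m : ℝ) (hm : 0 ≤ m) (h₁ : m < s * b) (h₂ : m < (s + 2) * b) :
    (ℝ →ᵇ ℝ) →L[ℝ] (ℝ →ᵇ ℝ) :=
  solOp (s * b) ((s + 2) * b) m hm h₁ h₂ ∘L ContinuousLinearMap.mul ℝ (ℝ →ᵇ ℝ) (linPot s b) ∘L evenProj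

theorem linT_apply {s b m : ℝ} (hm : 0 ≤ m) (h₁ : m < s * b) (h₂ : m < (s + 2) * b) (f : ℝ →ᵇ ℝ) :
    linT s b m hm h₁ h₂ f = solOp (s * b) ((s + 2) * b) m hm h₁ h₂ (linPot s b * evenProj f) := rfl

theorem eq_zero_of_linT_eq_self {s b m : ℝ} (hs : 0 < s) (hb : 0 < b) (hm : 0 ≤ m) (h₁ : m < s * b)
    (h₂ : m < (s + 2) * b) {f : ℝ →ᵇ ℝ} (hf : linT s b m hm h₁ h₂ f = f) : f = 0 := by
  rw [linT_apply] at hf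
  have hfe : ∀ x, f (-x) = f x := fun x => by
    rw [← hf]
    refine solOp_even hm h₁ h₂ (fun x => ?_) x
    simp only [BoundedContinuousFunction.mul_apply, linPot_neg, evenProj_neg]
  rw [evenProj_of_even hfe] at hf
  obtain ⟨κ, hκ0, k₁, k₂, kb⟩ : ∃ κ : ℝ, 0 < κ ∧ κ < s * b ∧ κ < (s + 2) * b ∧ κ ≤ b := by
    refine ⟨min (s * b / 2) b, lt_min (by positivity) hb, ?_, ?_, min_le_right _ _⟩
    · exact (min_le_left _ _).trans_lt (by linarith [mul_pos hs hb])
    · exact (min_le_left _ _).trans_lt (by nlinarith [mul_pos hs hb])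
  set Cp := (s + 1) * (s + 2) * (s + 3) * (s + 4) * b ^ 4 with hCp
  have hCp0 : 0 ≤ Cp := by positivity
  let G : ℝ →ᵇ ℝ := BoundedContinuousFunction.ofNormedAddCommGroup
    (fun x => cosh (κ * x) * (linPot s b x * f x / cosh (m * x)))
    (by
      have := continuous_div_cosh m (linPot s b * f)
      simp only [BoundedContinuousFunction.mul_apply] at this
      fun_prop) (Cp * ‖f‖) (fun x => by
      rw [mul_div_assoc, norm_mul, norm_mul, norm_eq_abs, norm_eq_abs, norm_eq_abs,
        abs_of_pos (cosh_pos _), ← mul_assoc]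
      refine mul_le_mul ?_ (abs_div_cosh_le_norm m f x) (abs_nonneg _) hCp0
      have h3 := abs_linPot_le hs hb x
      have h4 : cosh (κ * x) ≤ cosh (b * x) := by
        rw [cosh_le_cosh, abs_mul, abs_mul, abs_of_pos hκ0, abs_of_pos hb]
        gcongr
      calc cosh (κ * x) * |linPot s b x| ≤ cosh (b * x) * (Cp / cosh (b * x)) := by
            gcongr
        _ = Cp := mul_div_cancel₀ _ (cosh_pos _).ne')
  have hG : ∀ x, (linPot s b * f) x / cosh (m * x) = G x / cosh (κ * x) := fun x => by
    show _ = cosh (κ * x) * (linPot s b x * f x / cosh (m * x)) / cosh (κ * x)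
    rw [mul_div_cancel_left₀ _ (cosh_pos _).ne']
    rfl
  have hu := solOp_div_cosh_congr hm h₁ h₂ hκ0.le k₁ k₂ hG
  rw [hf] at hu
  obtain ⟨D1, D2, D3, hD⟩ := exists_solOp_chain (s * b) ((s + 2) * b) κ hκ0.le k₁ k₂
  obtain ⟨d0, d1, d2, d3⟩ := hD G
  have hz := even_kernel_trivial hs hb d0 d1 d2 (fun x => (d3 x).congr_deriv (by
      rw [← hG, ← hu]
      simp only [BoundedContinuousFunction.mul_apply, linPot_apply]
      ring))
    (fun x => by rw [← hu, ← hu, mul_neg, cosh_neg, hfe])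
    (tendsto_div_cosh_atTop hκ0 _) (tendsto_div_cosh_atTop hκ0 _) (tendsto_div_cosh_atTop hκ0 _)
    (tendsto_div_cosh_atTop hκ0 _)
  ext x
  have := congrFun hz x
  rw [← hu x] at this
  exact (div_eq_zero_iff.mp this).resolve_right (cosh_pos _).ne'

/-- Invertibility of the linearized operator on even functions. -/
theorem exists_inverse_one_sub_linT {s b m : ℝ} (hs : 0 < s) (hb : 0 < b) (hm : 0 ≤ m)
    (h₁ : m < s * b) (h₂ : m < (s + 2) * b) :
    ∃ B : (ℝ →ᵇ ℝ) →L[ℝ] (ℝ →ᵇ ℝ), (∀ f, B (f - linT s b m hm h₁ h₂ f) = f) ∧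
      (∀ f, B f - linT s b m hm h₁ h₂ (B f) = f) := by
  have hc : IsCompactOperator (linT s b m hm h₁ h₂) :=
    isCompactOperator_solOp_mul hm h₁ h₂ hb (abs_linPot_le hs hb) (linPot_neg s b)
  rcases hc.hasEigenvalue_or_mem_resolventSet one_ne_zero with h | h
  · obtain ⟨f, hf⟩ := h.exists_hasEigenvector
    refine absurd (eq_zero_of_linT_eq_self hs hb hm h₁ h₂ (f := f) ?_) hf.2
    simpa using hf.apply_eq_smul
  · rw [spectrum.mem_resolventSet_iff, map_one] at h
    obtain ⟨B, hB⟩ := h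
    refine ⟨(↑B⁻¹ : (ℝ →ᵇ ℝ) →L[ℝ] (ℝ →ᵇ ℝ)), fun f => ?_, fun f => ?_⟩
    · have := congrArg (fun L : (ℝ →ᵇ ℝ) →L[ℝ] (ℝ →ᵇ ℝ) => L f) B.inv_mul
      rw [hB] at this
      exact this
    · have := congrArg (fun L : (ℝ →ᵇ ℝ) →L[ℝ] (ℝ →ᵇ ℝ) => L f) B.mul_inv
      rw [hB] at this
      exact this

end Invertibility

section FixedPoint
open Set Filter Topology BoundedContinuousFunction

/-- A quantitative implicit function theorem for fixed points. -/
theorem exists_local_fixedPoints {X : Type*} [NormedAddCommGroup X] [NormedSpace ℝ X] [CompleteSpace X]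
    {T B : X →L[ℝ] X} (hB : ∀ f, B (f - T f) = f) (hB' : ∀ f, B f - T (B f) = f)
    {Ψ : ℝ → X → X} {f₀ : X} (h0 : Ψ 0 f₀ = f₀)
    (hΨ : ∀ θ > 0, ∃ r > 0, ∀ μ : ℝ, |μ| ≤ r → ∀ f ∈ Metric.closedBall f₀ r,
      ∀ g ∈ Metric.closedBall f₀ r, ‖Ψ μ f - Ψ μ g - T (f - g)‖ ≤ θ * ‖f - g‖)
    {L : ℝ} (hL : ∀ μ μ' : ℝ, ∀ g ∈ Metric.closedBall f₀ 1, ‖Ψ μ g - Ψ μ' g‖ ≤ L * |μ - μ'|) :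
    ∃ r > 0, ∃ ε > 0, ∃ L' : ℝ,
      (∀ μ μ' : ℝ, |μ| ≤ ε → |μ'| ≤ ε → ∀ f ∈ Metric.closedBall f₀ r, ∀ g ∈ Metric.closedBall f₀ r,
        Ψ μ f = f → Ψ μ' g = g → ‖f - g‖ ≤ L' * |μ - μ'|) ∧
      (∀ μ : ℝ, |μ| ≤ ε → ∃ f ∈ Metric.closedBall f₀ r, Ψ μ f = f) := by
  have hb : 0 < ‖B‖ + 1 := by positivity
  obtain ⟨r₁, hr₁, H⟩ := hΨ (1 / (2 * (‖B‖ + 1))) (by positivity)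
  have hBθ : ∀ x : ℝ, 0 ≤ x → ‖B‖ * (1 / (2 * (‖B‖ + 1)) * x) ≤ x / 2 := fun x hx => by
    have e : x / 2 = (‖B‖ + 1) * (1 / (2 * (‖B‖ + 1)) * x) := by field_simp
    rw [e]
    have : 0 ≤ 1 / (2 * (‖B‖ + 1)) * x := by positivity
    nlinarith
  have hL0 : 0 ≤ L := by
    have := (norm_nonneg _).trans (hL 1 0 f₀ (Metric.mem_closedBall_self zero_le_one))
    simpa using this
  set r := min r₁ 1 with hr
  have hr0 : 0 < r := lt_min hr₁ one_pos
  set ε := min r₁ (r / (2 * (‖B‖ * L + 1))) with hε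
  have hε0 : 0 < ε := lt_min hr₁ (by positivity)
  have sub₁ : ∀ {f}, f ∈ Metric.closedBall f₀ r → f ∈ Metric.closedBall f₀ r₁ := fun hf =>
    Metric.closedBall_subset_closedBall (min_le_left _ _) hf
  have sub₂ : ∀ {f}, f ∈ Metric.closedBall f₀ r → f ∈ Metric.closedBall f₀ 1 := fun hf =>
    Metric.closedBall_subset_closedBall (min_le_right _ _) hf
  refine ⟨r, hr0, ε, hε0, 2 * ‖B‖ * L, fun μ μ' hμ hμ' f hf g hg ef eg => ?_, fun μ hμ => ?_⟩
  · have e : f - g = B ((Ψ μ f - Ψ μ g - T (f - g)) + (Ψ μ g - Ψ μ' g)) := by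
      rw [ef, eg, ← hB (f - g)]
      congr 1
      rw [hB]
      abel
    have h1 : ‖f - g‖ ≤ ‖B‖ * (1 / (2 * (‖B‖ + 1)) * ‖f - g‖ + L * |μ - μ'|) := by
      conv_lhs => rw [e]
      refine (B.le_opNorm _).trans ?_
      gcongr
      exact (norm_add_le _ _).trans (add_le_add (H μ (hμ.trans (min_le_left _ _)) f (sub₁ hf) g (sub₁ hg))
        (hL μ μ' g (sub₂ hg)))
    have h2 := hBθ ‖f - g‖ (norm_nonneg _)
    rw [mul_add] at h1
    linarith
  · let Θ : X → X := fun f => B (Ψ μ f - T f)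
    have hcontr : ∀ f ∈ Metric.closedBall f₀ r, ∀ g ∈ Metric.closedBall f₀ r,
        ‖Θ f - Θ g‖ ≤ ‖f - g‖ / 2 := fun f hf g hg => by
      have e : Θ f - Θ g = B (Ψ μ f - Ψ μ g - T (f - g)) := by
        simp only [Θ, ← map_sub]
        congr 1
        rw [map_sub]
        abel
      rw [e]
      refine (B.le_opNorm _).trans (le_trans ?_ (hBθ _ (norm_nonneg _)))
      gcongr
      exact H μ (hμ.trans (min_le_left _ _)) f (sub₁ hf) g (sub₁ hg)
    have hf₀ : f₀ ∈ Metric.closedBall f₀ r := Metric.mem_closedBall_self hr0.le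
    have hΘ0 : ‖Θ f₀ - f₀‖ ≤ r / 2 := by
      have e : Θ f₀ - f₀ = B (Ψ μ f₀ - Ψ 0 f₀) := by
        calc Θ f₀ - f₀ = B (Ψ μ f₀ - T f₀) - B (f₀ - T f₀) := by rw [hB]
          _ = _ := by rw [← map_sub, h0, sub_sub_sub_cancel_right]
      rw [e]
      refine (B.le_opNorm _).trans ?_
      calc ‖B‖ * ‖Ψ μ f₀ - Ψ 0 f₀‖ ≤ ‖B‖ * (L * |μ - 0|) := by
            gcongr
            exact hL μ 0 f₀ (sub₂ hf₀)
        _ = ‖B‖ * L * |μ| := by rw [sub_zero, mul_assoc]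
        _ ≤ (‖B‖ * L + 1) * (r / (2 * (‖B‖ * L + 1))) := by
            gcongr
            · linarith
            · exact hμ.trans (min_le_right _ _)
        _ = r / 2 := by
            have : 0 ≤ ‖B‖ * L := by positivity
            field_simp
    have hmaps : MapsTo Θ (Metric.closedBall f₀ r) (Metric.closedBall f₀ r) := fun f hf => by
      rw [mem_closedBall_iff_norm]
      have h1 := hcontr f hf f₀ hf₀
      have h2 := norm_add_le (Θ f - Θ f₀) (Θ f₀ - f₀)
      rw [sub_add_sub_cancel] at h2
      rw [mem_closedBall_iff_norm] at hf
      linarith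
    obtain ⟨f, hf, hfix, -⟩ := ContractingWith.exists_fixedPoint' (K := 1 / 2)
      Metric.isClosed_closedBall.isComplete hmaps
      ⟨by norm_num, LipschitzWith.of_dist_le_mul fun f g => by
        have := hcontr f f.2 g g.2
        rw [Subtype.dist_eq, Subtype.dist_eq, dist_eq_norm, dist_eq_norm]
        push_cast
        simpa [div_eq_inv_mul] using this⟩ hf₀ (edist_ne_top _ _)
    refine ⟨f, hf, ?_⟩
    have h3 : Θ f = f := hfix
    have h4 := hB' (Ψ μ f - T f)
    change Θ f - T (Θ f) = _ at h4
    rw [h3] at h4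
    exact (sub_left_inj.mp h4).symm

/-- The power nonlinearity acting on weighted functions. -/
noncomputable def powW (α m : ℝ) (hα : 0 < α) (g : ℝ →ᵇ ℝ) : ℝ →ᵇ ℝ :=
  BoundedContinuousFunction.ofNormedAddCommGroup
    (fun x => cosh (m * x) * (g x / cosh (m * x)) ^ (α + 1))
    ((by fun_prop : Continuous fun x => cosh (m * x)).mul
      ((continuous_div_cosh m g).rpow_const fun x => Or.inr (by linarith)))
    (‖g‖ * ‖g‖ ^ α) (fun x => by
      have hc := cosh_pos (m * x)
      have h1 := abs_rpow_le_abs_rpow (g x / cosh (m * x)) (α + 1)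
      rw [rpow_add_one' (abs_nonneg _) (by linarith)] at h1
      rw [norm_mul, norm_eq_abs, norm_eq_abs, abs_of_pos hc]
      calc cosh (m * x) * |(g x / cosh (m * x)) ^ (α + 1)|
          ≤ cosh (m * x) * (|g x / cosh (m * x)| ^ α * |g x / cosh (m * x)|) := by gcongr
        _ = |g x| * |g x / cosh (m * x)| ^ α := by
            rw [abs_div, abs_of_pos hc]
            field_simp
        _ ≤ ‖g‖ * ‖g‖ ^ α := by
            gcongr
            · exact g.norm_coe_le_norm x
            · exact abs_div_cosh_le_norm m g x)

theorem powW_apply {α m : ℝ} (hα : 0 < α) (g : ℝ →ᵇ ℝ) (x : ℝ) :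
    powW α m hα g x = cosh (m * x) * (g x / cosh (m * x)) ^ (α + 1) := rfl

theorem powW_div_cosh {α m : ℝ} (hα : 0 < α) (g : ℝ →ᵇ ℝ) (x : ℝ) :
    powW α m hα g x / cosh (m * x) = (g x / cosh (m * x)) ^ (α + 1) := by
  rw [powW_apply, mul_div_cancel_left₀ _ (cosh_pos _).ne']

/-- Uniform first order expansion of the power function on bounded sets. -/
theorem exists_rpow_linearization {α : ℝ} (hα : 0 < α) (R : ℝ) {θ : ℝ} (hθ : 0 < θ) :
    ∃ r > 0, ∀ y₀ y z : ℝ, |y₀| ≤ R → |y - y₀| ≤ r → |z - y₀| ≤ r →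
      |y ^ (α + 1) - z ^ (α + 1) - (α + 1) * y₀ ^ α * (y - z)| ≤ θ * |y - z| := by
  have hcont : Continuous fun y : ℝ => (α + 1) * y ^ α :=
    continuous_const.mul (continuous_id.rpow_const fun x => Or.inr hα.le)
  have huc := isCompact_Icc.uniformContinuousOn_of_continuous
    (hcont.continuousOn (s := Icc (-(R + 1)) (R + 1)))
  obtain ⟨d, hd, hunif⟩ := Metric.uniformContinuousOn_iff.mp huc θ hθ
  refine ⟨min (d / 2) 1, lt_min (by linarith) one_pos, fun y₀ y z hy₀ hy hz => ?_⟩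
  have hder : ∀ ξ : ℝ, HasDerivAt (fun ξ : ℝ => ξ ^ (α + 1) - (α + 1) * y₀ ^ α * ξ)
      ((α + 1) * ξ ^ α - (α + 1) * y₀ ^ α) ξ := fun ξ => by
    have h1 := hasDerivAt_rpow_const (x := ξ) (p := α + 1) (Or.inr (by linarith))
    have h2 := (hasDerivAt_id ξ).const_mul ((α + 1) * y₀ ^ α)
    rw [add_sub_cancel_right] at h1
    exact (h1.sub h2).congr_deriv (by simp)
  have hb : ∀ ξ ∈ Metric.closedBall y₀ (min (d / 2) 1), ‖(α + 1) * ξ ^ α - (α + 1) * y₀ ^ α‖ ≤ θ := by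
    intro ξ hξ
    rw [Metric.mem_closedBall, dist_eq] at hξ
    have h1 := hξ.trans (min_le_left _ _)
    have h2 := hξ.trans (min_le_right _ _)
    have h3 := abs_le.mp h2
    have h4 := abs_le.mp hy₀
    refine (hunif ξ ⟨by linarith, by linarith⟩ y₀ ⟨by linarith, by linarith⟩ ?_).le
    rw [dist_eq]
    linarith
  have := (convex_closedBall y₀ (min (d / 2) 1)).norm_image_sub_le_of_norm_hasDerivWithin_le
    (fun ξ _ => (hder ξ).hasDerivWithinAt) hb (x := z) (y := y) (by simpa [dist_eq] using hz)
    (by simpa [dist_eq] using hy)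
  rw [norm_eq_abs, norm_eq_abs] at this
  convert this using 2
  ring

theorem exists_powW_linearization {α m : ℝ} (hα : 0 < α) {f₀ p : ℝ →ᵇ ℝ}
    (hp : ∀ x, p x = (α + 1) * (f₀ x / cosh (m * x)) ^ α) {θ : ℝ} (hθ : 0 < θ) :
    ∃ r > 0, ∀ f ∈ Metric.closedBall f₀ r, ∀ g ∈ Metric.closedBall f₀ r,
      ‖powW α m hα f - powW α m hα g - p * (f - g)‖ ≤ θ * ‖f - g‖ := by
  obtain ⟨r, hr, H⟩ := exists_rpow_linearization hα ‖f₀‖ hθ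
  refine ⟨r, hr, fun f hf g hg => (BoundedContinuousFunction.norm_le (by positivity)).mpr fun x => ?_⟩
  have hc := cosh_pos (m * x)
  have hball : ∀ f ∈ Metric.closedBall f₀ r, |f x / cosh (m * x) - f₀ x / cosh (m * x)| ≤ r := by
    intro f hf
    rw [mem_closedBall_iff_norm] at hf
    have := abs_div_cosh_le_norm m (f - f₀) x
    rw [BoundedContinuousFunction.sub_apply, sub_div] at this
    exact this.trans hf
  have h1 := H (f₀ x / cosh (m * x)) (f x / cosh (m * x)) (g x / cosh (m * x))
    (abs_div_cosh_le_norm m f₀ x) (hball f hf) (hball g hg)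
  have h2 : (powW α m hα f - powW α m hα g - p * (f - g)) x = cosh (m * x) *
      ((f x / cosh (m * x)) ^ (α + 1) - (g x / cosh (m * x)) ^ (α + 1)
        - (α + 1) * (f₀ x / cosh (m * x)) ^ α * (f x / cosh (m * x) - g x / cosh (m * x))) := by
    simp only [BoundedContinuousFunction.sub_apply, BoundedContinuousFunction.mul_apply, powW_apply, hp]
    field_simp
  rw [h2, norm_mul, norm_eq_abs, norm_eq_abs, abs_of_pos hc]
  calc _ ≤ cosh (m * x) * (θ * |f x / cosh (m * x) - g x / cosh (m * x)|) := by gcongr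
    _ = θ * |f x - g x| := by
      rw [← sub_div, abs_div, abs_of_pos hc]
      field_simp
    _ ≤ θ * ‖f - g‖ := by
      gcongr
      exact (f - g).norm_coe_le_norm x

/-- The fixed point map whose even fixed points are the solitary waves of frequency `ω₀ + μ`. -/
noncomputable def waveMap (α s b m : ℝ) (hα : 0 < α) (hm : 0 ≤ m) (h₁ : m < s * b)
    (h₂ : m < (s + 2) * b) (μ : ℝ) (f : ℝ →ᵇ ℝ) : ℝ →ᵇ ℝ :=
  solOp (s * b) ((s + 2) * b) m hm h₁ h₂ (powW α m hα (evenProj f) - μ • evenProj f)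

theorem exists_local_fixedPoints_waveMap {α s b m : ℝ} (hα : 0 < α) (hs : 0 < s) (hb : 0 < b)
    (hm : 0 ≤ m) (h₁ : m < s * b) (h₂ : m < (s + 2) * b) {f₀ : ℝ →ᵇ ℝ} (hf₀ : ∀ x, f₀ (-x) = f₀ x)
    (hp : ∀ x, linPot s b x = (α + 1) * (f₀ x / cosh (m * x)) ^ α)
    (hfix : waveMap α s b m hα hm h₁ h₂ 0 f₀ = f₀) :
    ∃ r > 0, ∃ ε > 0, ∃ L : ℝ,
      (∀ μ μ' : ℝ, |μ| ≤ ε → |μ'| ≤ ε → ∀ f ∈ Metric.closedBall f₀ r, ∀ g ∈ Metric.closedBall f₀ r,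
        waveMap α s b m hα hm h₁ h₂ μ f = f → waveMap α s b m hα hm h₁ h₂ μ' g = g →
        ‖f - g‖ ≤ L * |μ - μ'|) ∧
      (∀ μ : ℝ, |μ| ≤ ε → ∃ f ∈ Metric.closedBall f₀ r, waveMap α s b m hα hm h₁ h₂ μ f = f) := by
  obtain ⟨B, hB, hB'⟩ := exists_inverse_one_sub_linT hs hb hm h₁ h₂
  set S := solOp (s * b) ((s + 2) * b) m hm h₁ h₂ with hS
  have hP : ∀ {r : ℝ} {f}, f ∈ Metric.closedBall f₀ r → evenProj f ∈ Metric.closedBall f₀ r :=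
    fun {r f} hf => by
      rw [mem_closedBall_iff_norm] at hf ⊢
      conv_lhs => rw [← evenProj_of_even hf₀, ← map_sub]
      exact (norm_evenProj_le _).trans hf
  have hSn : 0 < ‖S‖ + 1 := by positivity
  refine exists_local_fixedPoints hB hB' hfix (fun θ hθ => ?_)
    (L := ‖S‖ * (‖f₀‖ + 1)) (fun μ μ' g hg => ?_)
  · obtain ⟨r, hr, H⟩ := exists_powW_linearization (m := m) hα hp
      (θ := θ / (2 * (‖S‖ + 1))) (by positivity)
    refine ⟨min r (θ / (2 * (‖S‖ + 1))), lt_min hr (by positivity), fun μ hμ f hf g hg => ?_⟩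
    have hf' := Metric.closedBall_subset_closedBall (min_le_left _ _) (hP hf)
    have hg' := Metric.closedBall_subset_closedBall (min_le_left _ _) (hP hg)
    have h3 := H _ hf' _ hg'
    have e : waveMap α s b m hα hm h₁ h₂ μ f - waveMap α s b m hα hm h₁ h₂ μ g
        - linT s b m hm h₁ h₂ (f - g) = S ((powW α m hα (evenProj f) - powW α m hα (evenProj g)
          - linPot s b * (evenProj f - evenProj g)) - μ • evenProj (f - g)) := by
      simp only [waveMap, linT_apply, ← hS, ← map_sub]
      congr 1
      rw [map_sub, smul_sub]
      abel
    rw [e]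
    have hPn : ‖evenProj f - evenProj g‖ ≤ ‖f - g‖ := by
      rw [← map_sub]
      exact norm_evenProj_le _
    calc _ ≤ ‖S‖ * (θ / (2 * (‖S‖ + 1)) * ‖f - g‖ + θ / (2 * (‖S‖ + 1)) * ‖f - g‖) := by
          refine (S.le_opNorm _).trans ?_
          gcongr
          refine (norm_sub_le _ _).trans (add_le_add (h3.trans (by gcongr)) ?_)
          rw [norm_smul, norm_eq_abs]
          exact mul_le_mul (hμ.trans (min_le_right _ _)) (norm_evenProj_le _) (norm_nonneg _)
            (by positivity)
      _ ≤ (‖S‖ + 1) * (θ / (2 * (‖S‖ + 1)) * ‖f - g‖ + θ / (2 * (‖S‖ + 1)) * ‖f - g‖) := by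
          gcongr
          linarith
      _ = θ * ‖f - g‖ := by
          field_simp
          ring
  · have e : waveMap α s b m hα hm h₁ h₂ μ g - waveMap α s b m hα hm h₁ h₂ μ' g
        = S ((μ' - μ) • evenProj g) := by
      simp only [waveMap, ← hS, ← map_sub]
      congr 1
      module
    rw [e]
    refine (S.le_opNorm _).trans ?_
    rw [norm_smul, norm_eq_abs, abs_sub_comm, mul_comm |μ - μ'|, ← mul_assoc]
    gcongr
    refine (norm_evenProj_le g).trans ?_
    rw [mem_closedBall_iff_norm] at hg
    linarith [norm_le_norm_add_norm_sub' g f₀]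

end FixedPoint

section Regularity
open Set Filter Topology BoundedContinuousFunction

theorem iteratedDeriv_eq_of_hasDerivAt {u : ℕ → ℝ → ℝ} {n : ℕ}
    (h : ∀ k < n, ∀ x, HasDerivAt (u k) (u (k + 1) x) x) :
    ∀ k ≤ n, iteratedDeriv k (u 0) = u k := by
  intro k
  induction k with
  | zero => intro _; rw [iteratedDeriv_zero]
  | succ k ih =>
    intro hk
    rw [iteratedDeriv_succ, ih (by omega)]
    exact funext fun x => (h k (by omega) x).deriv

theorem contDiff_of_hasDerivAt {u : ℕ → ℝ → ℝ} {n : ℕ}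
    (h : ∀ k < n, ∀ x, HasDerivAt (u k) (u (k + 1) x) x) (hc : Continuous (u n)) :
    ContDiff ℝ n (u 0) := by
  have e := iteratedDeriv_eq_of_hasDerivAt h
  refine contDiff_nat_iff_iteratedDeriv.mpr ⟨fun k hk => ?_, fun k hk => ?_⟩
  · rw [e k hk]
    rcases hk.eq_or_lt with rfl | hk
    · exact hc
    · exact continuous_of_hasDerivAt (h k hk)
  · rw [e k hk.le]
    exact fun x => (h k hk x).differentiableAt

theorem ContDiff.hasDerivAt_iteratedDeriv {u : ℝ → ℝ} {n k : ℕ} (hu : ContDiff ℝ n u) (hk : k < n)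
    (x : ℝ) : HasDerivAt (iteratedDeriv k u) (iteratedDeriv (k + 1) u x) x := by
  rw [iteratedDeriv_succ]
  exact ((contDiff_nat_iff_iteratedDeriv.mp hu).2 k hk x).hasDerivAt

/-- The derivatives of `solOp F` are bounded linear images of `F`, with the same weight. -/
theorem exists_iteratedDeriv_solOp {a₁ a₂ m : ℝ} (hm : 0 ≤ m) (h₁ : m < a₁) (h₂ : m < a₂) :
    ∃ E : ℕ → (ℝ →ᵇ ℝ) →L[ℝ] (ℝ →ᵇ ℝ), ∀ F : ℝ →ᵇ ℝ,
      ContDiff ℝ 4 (fun x => solOp a₁ a₂ m hm h₁ h₂ F x / cosh (m * x)) ∧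
      (∀ k ≤ 4, ∀ x, iteratedDeriv k (fun x => solOp a₁ a₂ m hm h₁ h₂ F x / cosh (m * x)) x =
        E k F x / cosh (m * x)) ∧
      (∀ x, iteratedDeriv 4 (fun x => solOp a₁ a₂ m hm h₁ h₂ F x / cosh (m * x)) x =
        (a₁ ^ 2 + a₂ ^ 2) * iteratedDeriv 2 (fun x => solOp a₁ a₂ m hm h₁ h₂ F x / cosh (m * x)) x
        - a₁ ^ 2 * a₂ ^ 2 * (solOp a₁ a₂ m hm h₁ h₂ F x / cosh (m * x)) + F x / cosh (m * x)) := by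
  obtain ⟨D1, D2, D3, hD⟩ := exists_solOp_chain a₁ a₂ m hm h₁ h₂
  let E : ℕ → (ℝ →ᵇ ℝ) →L[ℝ] (ℝ →ᵇ ℝ) := fun k => match k with
    | 0 => solOp a₁ a₂ m hm h₁ h₂
    | 1 => D1
    | 2 => D2
    | 3 => D3
    | _ => (a₁ ^ 2 + a₂ ^ 2) • D2 - (a₁ ^ 2 * a₂ ^ 2) • solOp a₁ a₂ m hm h₁ h₂
        + ContinuousLinearMap.id ℝ (ℝ →ᵇ ℝ)
  refine ⟨E, fun F => ?_⟩
  obtain ⟨d0, d1, d2, d3⟩ := hD F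
  have e4 : ∀ x, E 4 F x / cosh (m * x) = (a₁ ^ 2 + a₂ ^ 2) * (D2 F x / cosh (m * x))
      - a₁ ^ 2 * a₂ ^ 2 * (solOp a₁ a₂ m hm h₁ h₂ F x / cosh (m * x)) + F x / cosh (m * x) := fun x => by
    change ((a₁ ^ 2 + a₂ ^ 2) * D2 F x - a₁ ^ 2 * a₂ ^ 2 * solOp a₁ a₂ m hm h₁ h₂ F x + F x)
      / cosh (m * x) = _
    ring
  have h : ∀ k < 4, ∀ x, HasDerivAt ((fun k x => E k F x / cosh (m * x)) k)
      ((fun k x => E k F x / cosh (m * x)) (k + 1) x) x := by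
    intro k hk x
    interval_cases k
    · exact d0 x
    · exact d1 x
    · exact d2 x
    · exact (d3 x).congr_deriv (e4 x).symm
  have hi := iteratedDeriv_eq_of_hasDerivAt h
  refine ⟨contDiff_of_hasDerivAt h (continuous_div_cosh m (E 4 F)), fun k hk x => congrFun (hi k hk) x,
    fun x => ?_⟩
  have i4 := congrFun (hi 4 le_rfl) x
  have i2 := congrFun (hi 2 (by norm_num)) x
  refine i4.trans ((e4 x).trans ?_)
  rw [← show _ = D2 F x / cosh (m * x) from i2]
  rfl

theorem eq_solOp_of_contDiff {a₁ a₂ m D : ℝ} (hm : 0 ≤ m) (h₁ : m < a₁) (h₂ : m < a₂) (F : ℝ →ᵇ ℝ)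
    {u : ℝ → ℝ} (hu : ContDiff ℝ 4 u)
    (h : ∀ x, iteratedDeriv 4 u x = (a₁ ^ 2 + a₂ ^ 2) * iteratedDeriv 2 u x - a₁ ^ 2 * a₂ ^ 2 * u x
      + F x / cosh (m * x))
    (hb : ∀ k ≤ 3, ∀ x, |iteratedDeriv k u x| ≤ D) (x : ℝ) :
    u x = solOp a₁ a₂ m hm h₁ h₂ F x / cosh (m * x) := by
  have hd : ∀ k < 4, ∀ x, HasDerivAt (iteratedDeriv k u) (iteratedDeriv (k + 1) u x) x :=
    fun k hk x => ContDiff.hasDerivAt_iteratedDeriv (n := 4) (mod_cast hu) hk x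
  have d0 := hd 0 (by norm_num)
  have b0 := hb 0 (by norm_num)
  rw [iteratedDeriv_zero] at d0 b0
  exact eq_solOp_of_hasDerivAt hm h₁ h₂ F d0 (hd 1 (by norm_num)) (hd 2 (by norm_num))
    (fun x => (hd 3 (by norm_num) x).congr_deriv (h x)) b0 (hb 1 (by norm_num)) (hb 2 (by norm_num))
    (hb 3 (by norm_num)) x

end Regularity

section SquareIntegrable
open Set Filter Topology BoundedContinuousFunction

theorem integrable_inv_cosh_sq {m : ℝ} (hm : 0 < m) : Integrable fun x => 1 / cosh (m * x) ^ 2 := by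
  have h := integrable_inv_one_add_sq.comp_mul_left' hm.ne'
  refine h.mono' (by
    refine Continuous.aestronglyMeasurable ?_
    exact continuous_const.div (by fun_prop) fun x => by positivity) (ae_of_all _ fun x => ?_)
  rw [norm_eq_abs, abs_of_nonneg (by positivity), one_div]
  have h1 : |m * x| ≤ |sinh (m * x)| := by
    rw [abs_sinh]
    exact self_le_sinh_iff.mpr (abs_nonneg _)
  have h2 := sq_le_sq.mpr h1
  refine inv_anti₀ (by positivity) ?_
  rw [cosh_sq]
  linarith

theorem integrable_div_cosh_sq {m : ℝ} (hm : 0 < m) (f : ℝ →ᵇ ℝ) :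
    Integrable fun x => (f x / cosh (m * x)) ^ 2 := by
  refine ((integrable_inv_cosh_sq hm).const_mul (‖f‖ ^ 2)).mono'
    ((continuous_div_cosh m f).pow 2).aestronglyMeasurable (ae_of_all _ fun x => ?_)
  rw [norm_eq_abs, abs_of_nonneg (by positivity), div_pow, mul_one_div]
  gcongr ?_ / _
  exact sq_le_sq.mpr (by simpa using f.norm_coe_le_norm x)

theorem integral_div_cosh_sq_le {m : ℝ} (hm : 0 < m) (f : ℝ →ᵇ ℝ) :
    ∫ x, (f x / cosh (m * x)) ^ 2 ≤ (∫ x, 1 / cosh (m * x) ^ 2) * ‖f‖ ^ 2 := by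
  rw [mul_comm, ← integral_const_mul]
  refine integral_mono (integrable_div_cosh_sq hm f) ((integrable_inv_cosh_sq hm).const_mul _)
    fun x => ?_
  simp only []
  rw [div_pow, mul_one_div]
  gcongr ?_ / _
  exact sq_le_sq.mpr (by simpa using f.norm_coe_le_norm x)

/-- The one-dimensional Sobolev inequality. -/
theorem sq_le_integral_sq_add_integral_deriv_sq {g g' : ℝ → ℝ} (h : ∀ x, HasDerivAt g (g' x) x)
    (hg' : Continuous g') (h0 : Integrable fun x => g x ^ 2) (h1 : Integrable fun x => g' x ^ 2)
    (x : ℝ) : g x ^ 2 ≤ (∫ y, g y ^ 2) + ∫ y, g' y ^ 2 := by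
  have hg := continuous_of_hasDerivAt h
  have hd : ∀ y, HasDerivAt (fun y => g y ^ 2) (2 * g y * g' y) y := fun y =>
    ((h y).pow 2).congr_deriv (by norm_num)
  have hle : ∀ y, 2 * g y * g' y ≤ g y ^ 2 + g' y ^ 2 := fun y => two_mul_le_add_sq _ _
  have hi : Integrable fun y => 2 * g y * g' y := by
    refine (h0.add h1).mono' (by fun_prop : Continuous fun y => 2 * g y * g' y).aestronglyMeasurable
      (ae_of_all _ fun y => ?_)
    rw [norm_eq_abs, abs_le]
    have := sq_nonneg (g y + g' y)
    simp only [Pi.add_apply]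
    exact ⟨by nlinarith, hle y⟩
  have hlim := tendsto_zero_of_hasDerivAt_of_integrableOn_Iic (a := x) (fun y _ => hd y)
    hi.integrableOn h0.integrableOn
  have e := integral_Iic_of_hasDerivAt_of_tendsto' (a := x) (fun y _ => hd y) hi.integrableOn hlim
  rw [sub_zero] at e
  rw [← e, ← integral_add h0 h1]
  calc ∫ y in Iic x, 2 * g y * g' y ≤ ∫ y in Iic x, (g y ^ 2 + g' y ^ 2) :=
        setIntegral_mono hi.integrableOn (h0.add h1).integrableOn hle
    _ ≤ ∫ y, (g y ^ 2 + g' y ^ 2) :=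
        setIntegral_le_integral (h0.add h1) (ae_of_all _ fun y => by positivity)

theorem exists_bound_of_integrable_sq {u : ℝ → ℝ} (hu : ContDiff ℝ 4 u)
    (hi : ∀ k : ℕ, k ≤ 4 → Integrable fun x => (iteratedDeriv k u x) ^ 2) :
    ∃ D, ∀ k ≤ 3, ∀ x, |iteratedDeriv k u x| ≤ D := by
  have hu' : ContDiff ℝ (4 : ℕ) u := mod_cast hu
  have hc := (contDiff_nat_iff_iteratedDeriv.mp hu').1
  refine ⟨√((∑ k ∈ Finset.range 5, ∫ y, (iteratedDeriv k u y) ^ 2) +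
    ∑ k ∈ Finset.range 5, ∫ y, (iteratedDeriv k u y) ^ 2), fun k hk x => abs_le_sqrt ?_⟩
  have h1 := sq_le_integral_sq_add_integral_deriv_sq
    (hu'.hasDerivAt_iteratedDeriv (Nat.lt_succ_of_le hk)) (hc _ (Nat.succ_le_succ hk))
    (hi k (by omega)) (hi (k + 1) (by omega)) x
  have h2 : ∀ k ≤ 4, ∫ y, (iteratedDeriv k u y) ^ 2 ≤
      ∑ k ∈ Finset.range 5, ∫ y, (iteratedDeriv k u y) ^ 2 := fun k hk =>
    Finset.single_le_sum (f := fun k => ∫ y, (iteratedDeriv k u y) ^ 2)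
      (fun j _ => integral_nonneg fun y => sq_nonneg _) (Finset.mem_range.mpr (by omega))
  exact h1.trans (add_le_add (h2 k (by omega)) (h2 (k + 1) (by omega)))

theorem sq_sub_le_distH4sq {u v : ℝ → ℝ} (hu : ContDiff ℝ 4 u) (hv : ContDiff ℝ 4 v)
    (hiu : ∀ k : ℕ, k ≤ 4 → Integrable fun x => (iteratedDeriv k u x) ^ 2)
    (hiv : ∀ k : ℕ, k ≤ 4 → Integrable fun x => (iteratedDeriv k v x) ^ 2) (x : ℝ) :
    (u x - v x) ^ 2 ≤ distH4sq u v := by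
  have hu' : ContDiff ℝ (4 : ℕ) u := mod_cast hu
  have hv' : ContDiff ℝ (4 : ℕ) v := mod_cast hv
  have hcu := (contDiff_nat_iff_iteratedDeriv.mp hu').1
  have hcv := (contDiff_nat_iff_iteratedDeriv.mp hv').1
  have hi : ∀ k ≤ 4, Integrable fun x => (iteratedDeriv k u x - iteratedDeriv k v x) ^ 2 := by
    intro k hk
    refine (((hiu k hk).add (hiv k hk)).const_mul 2).mono'
      (((hcu k hk).sub (hcv k hk)).pow 2).aestronglyMeasurable (ae_of_all _ fun y => ?_)
    rw [norm_eq_abs, abs_of_nonneg (sq_nonneg _)]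
    have := sq_nonneg (iteratedDeriv k u y + iteratedDeriv k v y)
    simp only [Pi.add_apply]
    nlinarith
  have h1 := sq_le_integral_sq_add_integral_deriv_sq
    (fun x => (hu'.hasDerivAt_iteratedDeriv (k := 0) (by norm_num) x).sub
      (hv'.hasDerivAt_iteratedDeriv (k := 0) (by norm_num) x))
    ((hcu 1 (by norm_num)).sub (hcv 1 (by norm_num))) (hi 0 (by norm_num)) (hi 1 (by norm_num)) x
  have h2 : ∑ k ∈ Finset.range 2, ∫ x : ℝ, (iteratedDeriv k u x - iteratedDeriv k v x) ^ 2
      ≤ distH4sq u v :=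
    Finset.sum_le_sum_of_subset_of_nonneg (Finset.range_subset_range.mpr (by norm_num))
      fun k _ _ => integral_nonneg fun y => sq_nonneg _
  rw [Finset.sum_range_succ, Finset.sum_range_one] at h2
  simp only [iteratedDeriv_zero, Pi.sub_apply] at h1 h2
  exact h1.trans h2

end SquareIntegrable

section ExplicitWave
open Set Filter Topology BoundedContinuousFunction

theorem tanh_mem_Icc (x : ℝ) : tanh x ∈ Icc (-1 : ℝ) 1 := by
  have := one_sub_tanh_sq_pos x
  exact abs_le.mp (abs_le_one_iff_mul_self_le_one.mpr (by nlinarith))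

theorem cosh_mul_mul_cosh_rpow_neg_le {s b m : ℝ} (hs : 0 < s) (hb : 0 < b) (hm : 0 ≤ m)
    (h : m ≤ s * b) (x : ℝ) : cosh (m * x) * cosh (b * x) ^ (-s) ≤ 2 ^ s := by
  have h1 : cosh (m * x) ≤ exp (s * |b * x|) := by
    have e : |m * x| ≤ s * |b * x| := by
      rw [abs_mul, abs_mul, abs_of_nonneg hm, abs_of_pos hb, ← mul_assoc]
      gcongr
    rw [← cosh_abs]
    refine le_trans ?_ (exp_le_exp.mpr e)
    rw [cosh_eq]
    have := exp_le_exp.mpr (neg_le_self (abs_nonneg (m * x)))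
    linarith
  have h2 : exp |b * x| / 2 ≤ cosh (b * x) := by
    rw [← cosh_abs, cosh_eq]
    have := exp_pos (-|b * x|)
    linarith
  have h3 := rpow_le_rpow (by positivity) h2 hs.le
  rw [div_rpow (exp_pos _).le two_pos.le, ← exp_mul, mul_comm |b * x|, div_le_iff₀ (by positivity)] at h3
  rw [rpow_neg (cosh_pos _).le, ← div_eq_mul_inv, div_le_iff₀ (rpow_pos_of_pos (cosh_pos _) _)]
  linarith

/-- The profile `a * sech (b x) ^ s`, multiplied by the weight `cosh (m x)`. -/
noncomputable def waveBCF (a s b m : ℝ) (hs : 0 < s) (hb : 0 < b) (hm : 0 ≤ m) (h : m ≤ s * b) : ℝ →ᵇ ℝ :=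
  BoundedContinuousFunction.ofNormedAddCommGroup
    (fun x => cosh (m * x) * (a * cosh (b * x) ^ (-s)))
    ((by fun_prop : Continuous fun x => cosh (m * x)).mul
      (continuous_const.mul ((by fun_prop : Continuous fun x => cosh (b * x)).rpow_const
        fun x => Or.inl (cosh_pos _).ne')))
    (|a| * 2 ^ s) (fun x => by
      rw [mul_left_comm, norm_mul, norm_eq_abs, norm_eq_abs]
      have := cosh_pos (m * x)
      have := rpow_pos_of_pos (cosh_pos (b * x)) (-s)
      rw [abs_of_pos (by positivity : 0 < cosh (m * x) * cosh (b * x) ^ (-s))]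
      gcongr
      exact cosh_mul_mul_cosh_rpow_neg_le hs hb hm h x)

theorem waveBCF_apply {a s b m : ℝ} (hs : 0 < s) (hb : 0 < b) (hm : 0 ≤ m) (h : m ≤ s * b) (x : ℝ) :
    waveBCF a s b m hs hb hm h x = cosh (m * x) * (a * cosh (b * x) ^ (-s)) := rfl

theorem waveBCF_div_cosh {a s b m : ℝ} (hs : 0 < s) (hb : 0 < b) (hm : 0 ≤ m) (h : m ≤ s * b) (x : ℝ) :
    waveBCF a s b m hs hb hm h x / cosh (m * x) = a * cosh (b * x) ^ (-s) := by
  rw [waveBCF_apply, mul_div_cancel_left₀ _ (cosh_pos _).ne']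

theorem waveBCF_neg {a s b m : ℝ} (hs : 0 < s) (hb : 0 < b) (hm : 0 ≤ m) (h : m ≤ s * b) (x : ℝ) :
    waveBCF a s b m hs hb hm h (-x) = waveBCF a s b m hs hb hm h x := by
  simp only [waveBCF_apply, mul_neg, cosh_neg]

theorem wave_rpow {a s b α : ℝ} (ha : 0 < a) (hαs : α * s = 4)
    (haα : a ^ α = s * (s + 1) * (s + 2) * (s + 3) * b ^ 4) (x : ℝ) :
    (a * cosh (b * x) ^ (-s)) ^ α =
      s * (s + 1) * (s + 2) * (s + 3) * b ^ 4 * (1 - tanh (b * x) ^ 2) ^ 2 := by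
  have hc := cosh_pos (b * x)
  rw [mul_rpow ha.le (rpow_pos_of_pos hc _).le, haα, ← rpow_mul hc.le, one_sub_tanh_sq,
    show -s * α = -(4 : ℕ) by push_cast; linarith, rpow_neg hc.le, rpow_natCast]
  field_simp

theorem linPot_eq_wave_rpow {a s b α : ℝ} (ha : 0 < a) (hαs : α * s = 4)
    (haα : a ^ α = s * (s + 1) * (s + 2) * (s + 3) * b ^ 4) (x : ℝ) :
    linPot s b x = (α + 1) * (a * cosh (b * x) ^ (-s)) ^ α := by
  rw [wave_rpow ha hαs haα, linPot_apply]
  linear_combination -((s + 1) * (s + 2) * (s + 3) * b ^ 4 * (1 - tanh (b * x) ^ 2) ^ 2) * hαs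

theorem hasDerivAt_mul_cosh_rpow_neg (a s b : ℝ) {p : ℝ → ℝ} {p' x : ℝ}
    (hp : HasDerivAt p p' (tanh (b * x))) :
    HasDerivAt (fun x => p (tanh (b * x)) * (a * cosh (b * x) ^ (-s)))
      ((p' * (b * (1 - tanh (b * x) ^ 2)) - s * b * tanh (b * x) * p (tanh (b * x)))
        * (a * cosh (b * x) ^ (-s))) x := by
  have h1 : HasDerivAt (fun x => p (tanh (b * x))) (p' * (b * (1 - tanh (b * x) ^ 2))) x :=
    hp.comp x (hasDerivAt_tanh_mul b x)
  refine (h1.mul ((hasDerivAt_cosh_rpow_neg s b x).const_mul a)).congr_deriv ?_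
  ring

/-- The explicit wave is a fixed point at the explicit frequency. -/
theorem waveMap_waveBCF {α a s b m : ℝ} (hα : 0 < α) (ha : 0 < a) (hs : 0 < s) (hb : 0 < b) (hm : 0 ≤ m)
    (h₁ : m < s * b) (h₂ : m < (s + 2) * b) (hαs : α * s = 4)
    (haα : a ^ α = s * (s + 1) * (s + 2) * (s + 3) * b ^ 4) :
    waveMap α s b m hα hm h₁ h₂ 0 (waveBCF a s b m hs hb hm h₁.le) = waveBCF a s b m hs hb hm h₁.le := by
  set f₀ := waveBCF a s b m hs hb hm h₁.le with hf₀
  let P : ℕ → ℝ → ℝ := fun k t => match k with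
    | 0 => 1
    | 1 => -(s * b * t)
    | 2 => b ^ 2 * (s * (s + 1) * t ^ 2 - s)
    | _ => b ^ 2 * (s * (s + 1) * (2 * t)) * (b * (1 - t ^ 2))
        - s * b * t * (b ^ 2 * (s * (s + 1) * t ^ 2 - s))
  have hP : ∀ k, Continuous (P k) := fun k => by
    rcases k with _ | _ | _ | k <;> simp only [P] <;> fun_prop
  let φ : ℝ → ℝ := fun x => a * cosh (b * x) ^ (-s)
  have d0 : ∀ x, HasDerivAt (fun x => P 0 (tanh (b * x)) * φ x) (P 1 (tanh (b * x)) * φ x) x := fun x =>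
    (hasDerivAt_mul_cosh_rpow_neg a s b (hasDerivAt_const _ 1)).congr_deriv (by
      simp only [P, φ]; ring)
  have d1 : ∀ x, HasDerivAt (fun x => P 1 (tanh (b * x)) * φ x) (P 2 (tanh (b * x)) * φ x) x := fun x =>
    (hasDerivAt_mul_cosh_rpow_neg a s b ((hasDerivAt_id _).const_mul (s * b)).neg).congr_deriv (by
      simp only [P, φ, Pi.neg_apply, id]; ring)
  have d2 : ∀ x, HasDerivAt (fun x => P 2 (tanh (b * x)) * φ x) (P 3 (tanh (b * x)) * φ x) x := fun x =>
    (hasDerivAt_mul_cosh_rpow_neg a s b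
      ((((hasDerivAt_id _).pow 2).const_mul (s * (s + 1))).sub_const s |>.const_mul (b ^ 2))).congr_deriv (by
      simp only [P, φ, id]; norm_num)
  have hpow : ∀ x, f₀ x / cosh (m * x) = φ x := waveBCF_div_cosh hs hb hm h₁.le
  have hφ : ∀ x, 0 < φ x := fun x => mul_pos ha (rpow_pos_of_pos (cosh_pos _) _)
  have d3 : ∀ x, HasDerivAt (fun x => P 3 (tanh (b * x)) * φ x)
      (((s * b) ^ 2 + ((s + 2) * b) ^ 2) * (P 2 (tanh (b * x)) * φ x)
        - (s * b) ^ 2 * ((s + 2) * b) ^ 2 * (P 0 (tanh (b * x)) * φ x)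
        + (powW α m hα f₀) x / cosh (m * x)) x := fun x => by
    have hp := (((((hasDerivAt_id (tanh (b * x))).const_mul 2).const_mul (s * (s + 1))).const_mul
      (b ^ 2)).mul ((((hasDerivAt_id (tanh (b * x))).pow 2).const_sub 1).const_mul b)).sub
      (((hasDerivAt_id (tanh (b * x))).const_mul (s * b)).mul
      ((((hasDerivAt_id (tanh (b * x))).pow 2).const_mul (s * (s + 1))).sub_const s |>.const_mul (b ^ 2)))
    refine (hasDerivAt_mul_cosh_rpow_neg a s b hp).congr_deriv ?_
    rw [powW_div_cosh, hpow, rpow_add_one (hφ x).ne', wave_rpow ha hαs haα]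
    simp only [P, φ, id, Pi.mul_apply, Pi.sub_apply, Pi.pow_apply]
    norm_num
    ring
  have hbd : ∀ k, ∃ D, ∀ x, |P k (tanh (b * x)) * φ x| ≤ D := fun k => by
    obtain ⟨C, hC⟩ := isCompact_Icc.exists_bound_of_continuousOn (hP k).continuousOn (s := Icc (-1) 1)
    refine ⟨C * ‖f₀‖, fun x => ?_⟩
    rw [abs_mul, ← hpow]
    have h1 := hC _ (tanh_mem_Icc (b * x))
    rw [norm_eq_abs] at h1
    gcongr
    · exact (abs_nonneg _).trans h1
    · exact abs_div_cosh_le_norm m f₀ x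
  choose D hD using hbd
  have hDm : ∀ k ≤ 3, ∀ x, |P k (tanh (b * x)) * φ x| ≤ max (max (D 0) (D 1)) (max (D 2) (D 3)) := by
    intro k hk x
    refine (hD k x).trans ?_
    interval_cases k <;> simp
  have key := eq_solOp_of_hasDerivAt hm h₁ h₂ (powW α m hα f₀) d0 d1 d2 d3 (hDm 0 (by norm_num))
    (hDm 1 (by norm_num)) (hDm 2 (by norm_num)) (hDm 3 (by norm_num))
  have hev : evenProj f₀ = f₀ := evenProj_of_even (waveBCF_neg hs _ hm h₁.le)
  ext x
  have h1 := key x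
  simp only [P, one_mul] at h1
  rw [← hpow, div_left_inj' (cosh_pos _).ne'] at h1
  rw [waveMap, hev, zero_smul, sub_zero, ← h1]

end ExplicitWave

section SolitaryWave
open Set Filter Topology BoundedContinuousFunction

/-- `u` is an even `H⁴` solution of the solitary wave equation of frequency `ω`. -/
structure IsEvenWave (α ω : ℝ) (u : ℝ → ℝ) : Prop where
  contDiff : ContDiff ℝ 4 u
  even : ∀ x, u (-x) = u x
  integrable : ∀ k : ℕ, k ≤ 4 → Integrable fun x => (iteratedDeriv k u x) ^ 2
  equation : ∀ x, iteratedDeriv 4 u x - iteratedDeriv 2 u x + ω * u x - u x ^ (α + 1) = 0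

theorem waveMap_even {α s b m μ : ℝ} (hα : 0 < α) (hm : 0 ≤ m) (h₁ : m < s * b) (h₂ : m < (s + 2) * b)
    (f : ℝ →ᵇ ℝ) (x : ℝ) :
    waveMap α s b m hα hm h₁ h₂ μ f (-x) = waveMap α s b m hα hm h₁ h₂ μ f x := by
  refine solOp_even hm h₁ h₂ (fun x => ?_) x
  simp only [BoundedContinuousFunction.sub_apply, BoundedContinuousFunction.smul_apply, powW_apply,
    evenProj_neg, mul_neg, cosh_neg]

theorem eq_solOp_of_waveMap_eq {α s b m μ : ℝ} (hα : 0 < α) (hm : 0 ≤ m) (h₁ : m < s * b)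
    (h₂ : m < (s + 2) * b) {f : ℝ →ᵇ ℝ} (hf : waveMap α s b m hα hm h₁ h₂ μ f = f) :
    solOp (s * b) ((s + 2) * b) m hm h₁ h₂ (powW α m hα f - μ • f) = f := by
  have he : evenProj f = f := evenProj_of_even fun x => by
    rw [← hf]
    exact waveMap_even hα hm h₁ h₂ f x
  rwa [waveMap, he] at hf

theorem isEvenWave_of_waveMap_eq {α s b m μ : ℝ} (hα : 0 < α) (hm : 0 < m) (h₁ : m < s * b)
    (h₂ : m < (s + 2) * b) (hsb : (s * b) ^ 2 + ((s + 2) * b) ^ 2 = 1) {f : ℝ →ᵇ ℝ}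
    (hf : waveMap α s b m hα hm.le h₁ h₂ μ f = f) :
    IsEvenWave α ((s * b) ^ 2 * ((s + 2) * b) ^ 2 + μ) fun x => f x / cosh (m * x) := by
  obtain ⟨E, hE⟩ := exists_iteratedDeriv_solOp hm.le h₁ h₂
  obtain ⟨e1, e2, e3⟩ := hE (powW α m hα f - μ • f)
  rw [eq_solOp_of_waveMap_eq hα hm.le h₁ h₂ hf] at e1 e2 e3
  refine ⟨e1, fun x => ?_, fun k hk => ?_, fun x => ?_⟩
  · rw [mul_neg, cosh_neg, ← hf, waveMap_even]
  · simp only [e2 k hk]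
    exact integrable_div_cosh_sq hm _
  · rw [e3, hsb, BoundedContinuousFunction.sub_apply, sub_div, powW_div_cosh,
      BoundedContinuousFunction.smul_apply, smul_eq_mul]
    ring

theorem IsEvenWave.exists_waveMap_eq {α s b μ : ℝ} {u : ℝ → ℝ} (hα : 0 < α) (h₁ : 0 < s * b)
    (h₂ : 0 < (s + 2) * b) (hsb : (s * b) ^ 2 + ((s + 2) * b) ^ 2 = 1)
    (hu : IsEvenWave α ((s * b) ^ 2 * ((s + 2) * b) ^ 2 + μ) u) :
    ∃ f : ℝ →ᵇ ℝ, (∀ x, f x = u x) ∧ waveMap α s b 0 hα le_rfl h₁ h₂ μ f = f := by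
  obtain ⟨D, hD⟩ := exists_bound_of_integrable_sq hu.contDiff hu.integrable
  let f : ℝ →ᵇ ℝ := BoundedContinuousFunction.ofNormedAddCommGroup u hu.contDiff.continuous D fun x => by
    simpa using hD 0 (by norm_num) x
  have hf : ∀ x, f x = u x := fun x => rfl
  refine ⟨f, hf, ?_⟩
  have he : evenProj f = f := evenProj_of_even hu.even
  have key := eq_solOp_of_contDiff le_rfl h₁ h₂ (powW α 0 hα f - μ • f) hu.contDiff (fun x => ?_) hD
  · ext x
    rw [waveMap, he]
    have := key x
    rw [zero_mul, cosh_zero, div_one] at this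
    exact this.symm
  · rw [BoundedContinuousFunction.sub_apply, sub_div, powW_div_cosh,
      BoundedContinuousFunction.smul_apply, smul_eq_mul, hsb, zero_mul, cosh_zero, div_one, div_one, hf]
    linear_combination hu.equation x

theorem exists_distH4sq_le {α s b m : ℝ} (hα : 0 < α) (hm : 0 < m) (h₁ : m < s * b)
    (h₂ : m < (s + 2) * b) {f₀ : ℝ →ᵇ ℝ}
    (hp : ∀ x, linPot s b x = (α + 1) * (f₀ x / cosh (m * x)) ^ α) :
    ∃ r > 0, ∃ C ≥ 0, ∀ μ μ' : ℝ, |μ| ≤ 1 → ∀ f ∈ Metric.closedBall f₀ r, ∀ g ∈ Metric.closedBall f₀ r,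
      waveMap α s b m hα hm.le h₁ h₂ μ f = f → waveMap α s b m hα hm.le h₁ h₂ μ' g = g →
      distH4sq (fun x => f x / cosh (m * x)) (fun x => g x / cosh (m * x)) ≤
        C * (‖f - g‖ + |μ - μ'|) ^ 2 := by
  obtain ⟨E, hE⟩ := exists_iteratedDeriv_solOp hm.le h₁ h₂
  obtain ⟨r, hr, H⟩ := exists_powW_linearization (m := m) hα hp one_pos
  set K := ‖linPot s b‖ + 2 + (‖f₀‖ + r) with hK
  have hK0 : 0 ≤ K := by positivity
  set J := ∫ x, 1 / cosh (m * x) ^ 2 with hJ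
  have hJ0 : 0 ≤ J := integral_nonneg fun x => by positivity
  refine ⟨r, hr, ∑ k ∈ Finset.range 5, J * (‖E k‖ * K) ^ 2,
    Finset.sum_nonneg fun k _ => by positivity, fun μ μ' hμ f hf g hg ef eg => ?_⟩
  obtain ⟨-, hFf, -⟩ := hE (powW α m hα f - μ • f)
  obtain ⟨-, hFg, -⟩ := hE (powW α m hα g - μ' • g)
  rw [eq_solOp_of_waveMap_eq hα hm.le h₁ h₂ ef] at hFf
  rw [eq_solOp_of_waveMap_eq hα hm.le h₁ h₂ eg] at hFg
  set F := (powW α m hα f - μ • f) - (powW α m hα g - μ' • g) with hF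
  have hFn : ‖F‖ ≤ K * (‖f - g‖ + |μ - μ'|) := by
    have e : F = (powW α m hα f - powW α m hα g - linPot s b * (f - g)) + linPot s b * (f - g)
        + ((-μ) • (f - g) + (-(μ - μ')) • g) := by
      rw [hF]
      module
    have hgn : ‖g‖ ≤ ‖f₀‖ + r := by
      rw [mem_closedBall_iff_norm] at hg
      linarith [norm_le_norm_add_norm_sub' g f₀]
    calc ‖F‖ ≤ (1 * ‖f - g‖ + ‖linPot s b‖ * ‖f - g‖) + (1 * ‖f - g‖ + |μ - μ'| * (‖f₀‖ + r)) := by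
          rw [e]
          refine (norm_add_le _ _).trans (add_le_add ((norm_add_le _ _).trans
            (add_le_add (H f hf g hg) (norm_mul_le _ _))) ((norm_add_le _ _).trans (add_le_add ?_ ?_)))
          · rw [norm_smul, norm_neg, norm_eq_abs]
            gcongr
          · rw [norm_smul, norm_neg, norm_eq_abs]
            gcongr
      _ ≤ _ := by
          have : 0 ≤ (‖f₀‖ + r) * ‖f - g‖ := by positivity
          have : 0 ≤ (‖linPot s b‖ + 2) * |μ - μ'| := by positivity
          rw [hK]
          nlinarith
  rw [distH4sq, Finset.sum_mul]
  refine Finset.sum_le_sum fun k hk => ?_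
  have hk : k ≤ 4 := Nat.le_of_lt_succ (Finset.mem_range.mp hk)
  have e : ∀ x, iteratedDeriv k (fun x => f x / cosh (m * x)) x
      - iteratedDeriv k (fun x => g x / cosh (m * x)) x = E k F x / cosh (m * x) := fun x => by
    rw [hFf k hk, hFg k hk, ← sub_div, ← BoundedContinuousFunction.sub_apply, ← map_sub]
  simp only [e]
  refine (integral_div_cosh_sq_le hm _).trans ?_
  rw [mul_assoc, ← mul_pow, mul_assoc]
  gcongr
  exact ((E k).le_opNorm F).trans (by gcongr)

/-- For frequencies in `(0, 1/4)` a wave uniformly close to a positive function is positive. -/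
theorem IsEvenWave.pos {α ω η : ℝ} {u φ : ℝ → ℝ} (hα : 0 < α) (hω : 0 < ω) (hω' : ω < 1 / 4)
    (hu : IsEvenWave α ω u) (hφ : ∀ x, 0 < φ x) (hη : η ^ α < ω) (hη' : η < φ 0)
    (h : ∀ x, |u x - φ x| ≤ η) (x : ℝ) : 0 < u x := by
  obtain ⟨D, hD⟩ := exists_bound_of_integrable_sq hu.contDiff hu.integrable
  have hu' : ContDiff ℝ (4 : ℕ) u := mod_cast hu.contDiff
  set q := √(1 - 4 * ω) with hq
  have hq2 : q ^ 2 = 1 - 4 * ω := sq_sqrt (by linarith)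
  have hq0 : 0 ≤ q := sqrt_nonneg _
  have hq1 : q < 1 := by nlinarith
  set a₁ := √((1 - q) / 2) with ha₁
  set a₂ := √((1 + q) / 2) with ha₂
  have s₁ : a₁ ^ 2 = (1 - q) / 2 := sq_sqrt (by linarith)
  have s₂ : a₂ ^ 2 = (1 + q) / 2 := sq_sqrt (by linarith)
  have p₁ : 0 < a₁ := sqrt_pos.mpr (by linarith)
  have p₂ : 0 < a₂ := sqrt_pos.mpr (by linarith)
  have hsum : a₁ ^ 2 + a₂ ^ 2 = 1 := by rw [s₁, s₂]; ring
  have hprod : a₁ ^ 2 * a₂ ^ 2 = ω := by rw [s₁, s₂]; linear_combination -hq2 / 4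
  have hF : Continuous fun x => u x ^ (α + 1) :=
    hu.contDiff.continuous.rpow_const fun x => Or.inr (by linarith)
  have b0 : ∀ x, |u x| ≤ D := by simpa using hD 0 (by norm_num)
  have hFC : ∀ x, |u x ^ (α + 1)| ≤ D ^ (α + 1) := fun x =>
    (abs_rpow_le_abs_rpow _ _).trans (rpow_le_rpow (abs_nonneg _) (b0 x) (by linarith))
  have d0 : ∀ x, HasDerivAt u (iteratedDeriv 1 u x) x := by
    simpa using hu'.hasDerivAt_iteratedDeriv (k := 0) (by norm_num)
  have d1 := hu'.hasDerivAt_iteratedDeriv (k := 1) (by norm_num)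
  have d2 := hu'.hasDerivAt_iteratedDeriv (k := 2) (by norm_num)
  have d3 : ∀ x, HasDerivAt (iteratedDeriv 3 u) ((a₁ ^ 2 + a₂ ^ 2) * iteratedDeriv 2 u x
      - a₁ ^ 2 * a₂ ^ 2 * u x + u x ^ (α + 1)) x := fun x =>
    (hu'.hasDerivAt_iteratedDeriv (k := 3) (by norm_num) x).congr_deriv (by
      rw [hsum, hprod]
      linear_combination hu.equation x)
  have hbelow : ∀ x, -η ≤ u x := fun x => by
    have := (abs_le.mp (h x)).1
    linarith [hφ x]
  have hbdd : BddBelow (range u) := ⟨-η, by rintro _ ⟨x, rfl⟩; exact hbelow x⟩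
  have hinf : 0 ≤ ⨅ x, u x := by
    by_contra! hneg
    set M := -⨅ x, u x with hM
    have hM0 : 0 < M := by linarith
    have hMη : M ≤ η := by
      have := le_ciInf hbelow
      linarith
    have hFM : ∀ x, -M ^ (α + 1) ≤ u x ^ (α + 1) := fun x => by
      rcases le_total 0 (u x) with h0 | h0
      · have := rpow_nonneg h0 (α + 1)
        have := rpow_nonneg hM0.le (α + 1)
        linarith
      · have h1 : |u x| ≤ M := by
          rw [abs_of_nonpos h0]
          linarith [ciInf_le hbdd x]
        have h2 := (abs_rpow_le_abs_rpow (u x) (α + 1)).trans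
          (rpow_le_rpow (abs_nonneg _) h1 (by linarith))
        exact (abs_le.mp h2).1
    have h3 := le_ciInf (neg_le_of_hasDerivAt p₁ p₂ hF hFC d0 d1 d2 d3 b0 (hD 1 (by norm_num))
      (hD 2 (by norm_num)) (hD 3 (by norm_num)) hFM)
    rw [hprod, rpow_add_one hM0.ne'] at h3
    have h4 : M ≤ M ^ α * M / ω := by linarith
    rw [le_div_iff₀ hω, mul_comm] at h4
    have h5 := le_of_mul_le_mul_right h4 hM0
    have h6 := rpow_le_rpow hM0.le hMη hα.le
    linarith
  have hnn : ∀ x, 0 ≤ u x := fun x => hinf.trans (ciInf_le hbdd x)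
  have hu0 : 0 < u 0 := by
    have := (abs_le.mp (h 0)).1
    linarith
  exact pos_of_hasDerivAt p₁ p₂ hF hFC d0 d1 d2 d3 b0 (hD 1 (by norm_num)) (hD 2 (by norm_num))
    (hD 3 (by norm_num)) (fun x => rpow_nonneg (hnn x) _) (rpow_pos_of_pos hu0 _) x

/-- The local curve of fixed points through the explicit wave, with a Lipschitz bound in `H⁴`. -/
theorem exists_curve_of_waveMap {α a s b : ℝ} (hα : 0 < α) (ha : 0 < a) (hs : 0 < s) (hb : 0 < b)
    (hαs : α * s = 4) (haα : a ^ α = s * (s + 1) * (s + 2) * (s + 3) * b ^ 4)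
    (hsb : (s * b) ^ 2 + ((s + 2) * b) ^ 2 = 1) :
    ∃ ε > 0, ∃ K > 0, ∃ U : ℝ → ℝ → ℝ,
      (∀ μ, |μ| ≤ ε → IsEvenWave α ((s * b) ^ 2 * ((s + 2) * b) ^ 2 + μ) (U μ)) ∧
      (U 0 = fun x => a * cosh (b * x) ^ (-s)) ∧
      (∀ μ μ', |μ| ≤ ε → |μ'| ≤ ε → distH4sq (U μ) (U μ') ≤ (K * |μ - μ'|) ^ 2) := by
  set m := s * b / 2 with hm'
  have hm : 0 < m := by positivity
  have h₁ : m < s * b := half_lt_self (by positivity)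
  have h₂ : m < (s + 2) * b := by nlinarith
  set f₀ := waveBCF a s b m hs hb hm.le h₁.le with hf₀
  have hp : ∀ x, linPot s b x = (α + 1) * (f₀ x / cosh (m * x)) ^ α := fun x => by
    rw [waveBCF_div_cosh, linPot_eq_wave_rpow ha hαs haα]
  have hfix := waveMap_waveBCF hα ha hs hb hm.le h₁ h₂ hαs haα
  obtain ⟨r, hr, ε, hε, L, hL, hex⟩ := exists_local_fixedPoints_waveMap hα hs hb hm.le h₁ h₂
    (waveBCF_neg hs hb hm.le h₁.le) hp hfix
  obtain ⟨r', hr', C, hC, hdist⟩ := exists_distH4sq_le hα hm h₁ h₂ hp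
  have hball : f₀ ∈ Metric.closedBall f₀ r := Metric.mem_closedBall_self hr.le
  choose! f hf hffix using hex
  have hL0 : 0 < |L| + 1 := by positivity
  have hf0 : ∀ μ, |μ| ≤ ε → ‖f μ - f₀‖ ≤ (|L| + 1) * |μ| := fun μ hμ => by
    have h := hL μ 0 hμ (by simpa using hε.le) _ (hf μ hμ) _ hball (hffix μ hμ) hfix
    rw [sub_zero] at h
    refine h.trans ?_
    gcongr
    linarith [le_abs_self L]
  refine ⟨min ε (min 1 (r' / (|L| + 1))), by positivity, (C + 1) * (|L| + 2), by positivity,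
    fun μ x => f μ x / cosh (m * x), fun μ hμ => ?_, ?_, fun μ μ' hμ hμ' => ?_⟩
  · exact isEvenWave_of_waveMap_eq hα hm h₁ h₂ hsb (hffix μ (hμ.trans (min_le_left _ _)))
  · have h := hf0 0 (by simpa using hε.le)
    rw [abs_zero, mul_zero] at h
    have e : f 0 = f₀ := sub_eq_zero.mp (norm_le_zero_iff.mp h)
    ext x
    simp only [e]
    exact waveBCF_div_cosh hs hb hm.le h₁.le x
  · have hin : ∀ μ, |μ| ≤ min ε (min 1 (r' / (|L| + 1))) → f μ ∈ Metric.closedBall f₀ r' := by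
      intro μ hμ
      rw [mem_closedBall_iff_norm]
      refine (hf0 μ (hμ.trans (min_le_left _ _))).trans ?_
      rw [mul_comm, ← le_div_iff₀ hL0]
      exact hμ.trans ((min_le_right _ _).trans (min_le_right _ _))
    have hμε := hμ.trans (min_le_left _ _)
    have hμε' := hμ'.trans (min_le_left _ _)
    refine (hdist μ μ' (hμ.trans ((min_le_right _ _).trans (min_le_left _ _))) _ (hin μ hμ) _ (hin μ' hμ')
      (hffix μ hμε) (hffix μ' hμε')).trans ?_
    have h := hL μ μ' hμε hμε' _ (hf μ hμε) _ (hf μ' hμε') (hffix μ hμε) (hffix μ' hμε')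
    have h' : ‖f μ - f μ'‖ + |μ - μ'| ≤ (|L| + 2) * |μ - μ'| := by
      have := mul_le_mul_of_nonneg_right (le_abs_self L) (abs_nonneg (μ - μ'))
      linarith [abs_nonneg (μ - μ')]
    rw [mul_assoc, mul_pow (C + 1)]
    gcongr
    nlinarith

/-- Waves uniformly close to the explicit one are unique. -/
theorem exists_unique_radius {α a s b : ℝ} (hα : 0 < α) (ha : 0 < a) (hs : 0 < s) (hb : 0 < b)
    (hαs : α * s = 4) (haα : a ^ α = s * (s + 1) * (s + 2) * (s + 3) * b ^ 4)
    (hsb : (s * b) ^ 2 + ((s + 2) * b) ^ 2 = 1) :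
    ∃ r > 0, ∃ ε > 0, ∀ μ, |μ| ≤ ε → ∀ u v : ℝ → ℝ,
      IsEvenWave α ((s * b) ^ 2 * ((s + 2) * b) ^ 2 + μ) u →
      IsEvenWave α ((s * b) ^ 2 * ((s + 2) * b) ^ 2 + μ) v →
      (∀ x, |u x - a * cosh (b * x) ^ (-s)| ≤ r) → (∀ x, |v x - a * cosh (b * x) ^ (-s)| ≤ r) →
      u = v := by
  have h₁ : 0 < s * b := by positivity
  have h₂ : 0 < (s + 2) * b := by positivity
  set f₀ := waveBCF a s b 0 hs hb le_rfl h₁.le with hf₀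
  have hf₀x : ∀ x, f₀ x = a * cosh (b * x) ^ (-s) := fun x => by simp [hf₀, waveBCF_apply]
  obtain ⟨r, hr, ε, hε, L, hL, -⟩ := exists_local_fixedPoints_waveMap hα hs hb le_rfl h₁ h₂
    (waveBCF_neg (a := a) hs hb le_rfl h₁.le)
    (fun x => by rw [waveBCF_div_cosh, linPot_eq_wave_rpow ha hαs haα])
    (waveMap_waveBCF hα ha hs hb le_rfl h₁ h₂ hαs haα)
  refine ⟨r, hr, ε, hε, fun μ hμ u v hu hv hur hvr => ?_⟩
  obtain ⟨f, hfu, hf⟩ := hu.exists_waveMap_eq hα h₁ h₂ hsb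
  obtain ⟨g, hgv, hg⟩ := hv.exists_waveMap_eq hα h₁ h₂ hsb
  have hmem : ∀ (f : ℝ →ᵇ ℝ) (u : ℝ → ℝ), (∀ x, f x = u x) →
      (∀ x, |u x - a * cosh (b * x) ^ (-s)| ≤ r) → f ∈ Metric.closedBall f₀ r := fun f u hfu hur => by
    rw [mem_closedBall_iff_norm, BoundedContinuousFunction.norm_le hr.le]
    intro x
    rw [BoundedContinuousFunction.sub_apply, hfu, hf₀x]
    exact hur x
  have h := hL μ μ hμ hμ f (hmem f u hfu hur) g (hmem g v hgv hvr) hf hg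
  rw [sub_self, abs_zero, mul_zero] at h
  have e : f = g := sub_eq_zero.mp (norm_le_zero_iff.mp h)
  ext x
  rw [← hfu, ← hgv, e]

end SolitaryWave

/-- Existence of a locally unique smooth curve `ω ↦ φ_ω` of even, positive solitary
waves of the fourth-order NLS through the explicit solution at `ω = ω₀`. -/
theorem exists_local_curve_of_solitary_waves (α : ℝ) (hα : 0 < α)
    (a₀ b₀ ω₀ : ℝ)
    (ha : a₀ = ((3*α^3 + 22*α^2 + 48*α + 32) / (2*(α^2 + 4*α + 8)^2)) ^ (1/α))
    (hb : b₀ = α / (2 * Real.sqrt (α^2 + 4*α + 8)))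
    (hω : ω₀ = 4*(α^2 + 4*α + 4) / (α^4 + 8*α^3 + 32*α^2 + 64*α + 64))
    (φ : ℝ → ℝ)
    (hφ : ∀ x, φ x = a₀ * (Real.cosh (b₀ * x))⁻¹ ^ ((4:ℝ)/α)) :
    ∃ ε δ : ℝ, 0 < ε ∧ 0 < δ ∧ ∃ Φ : ℝ → ℝ → ℝ,
      -- (i) the curve passes through the explicit wave at ω₀
      Φ ω₀ = φ ∧
      (∀ ω ∈ Set.Ioo (ω₀ - ε) (ω₀ + ε),
        -- regularity, parity, positivity, square-integrability of derivatives
        ContDiff ℝ 4 (Φ ω) ∧ (∀ x, Φ ω (-x) = Φ ω x) ∧ (∀ x, 0 < Φ ω x) ∧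
        (∀ k : ℕ, k ≤ 4 → Integrable (fun x => (iteratedDeriv k (Φ ω) x)^2)) ∧
        -- (ii) the solitary-wave equation
        (∀ x, iteratedDeriv 4 (Φ ω) x - iteratedDeriv 2 (Φ ω) x + ω * Φ ω x
          - Φ ω x ^ (α + 1) = 0) ∧
        -- (iii) the curve stays δ-close to φ in H⁴, and is the unique such even solution
        distH4sq (Φ ω) φ < δ^2 ∧
        (∀ ψ : ℝ → ℝ, ContDiff ℝ 4 ψ → (∀ x, ψ (-x) = ψ x) →
          (∀ k : ℕ, k ≤ 4 → Integrable (fun x => (iteratedDeriv k ψ x)^2)) →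
          (∀ x, iteratedDeriv 4 ψ x - iteratedDeriv 2 ψ x + ω * ψ x
            - ψ x ^ (α + 1) = 0) →
          distH4sq ψ φ < δ^2 → ψ = Φ ω)) ∧
      -- (iv) continuity of ω ↦ Φ ω with respect to the H⁴ distance
      (∀ ω ∈ Set.Ioo (ω₀ - ε) (ω₀ + ε), ∀ η : ℝ, 0 < η → ∃ ρ : ℝ, 0 < ρ ∧
        ∀ ω' ∈ Set.Ioo (ω₀ - ε) (ω₀ + ε), |ω' - ω| < ρ →
          distH4sq (Φ ω') (Φ ω) < η^2) := by
  have hQ : 0 < α ^ 2 + 4 * α + 8 := by positivity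
  have hb0 : 0 < b₀ := by rw [hb]; positivity
  have hb2 : b₀ ^ 2 = α ^ 2 / (4 * (α ^ 2 + 4 * α + 8)) := by
    rw [hb, div_pow, mul_pow, sq_sqrt hQ.le]
    norm_num
  have ha0 : 0 < a₀ := by rw [ha]; positivity
  have haα : a₀ ^ α = 4 / α * (4 / α + 1) * (4 / α + 2) * (4 / α + 3) * b₀ ^ 4 := by
    rw [ha, ← rpow_mul (by positivity), one_div_mul_cancel hα.ne', rpow_one,
      show b₀ ^ 4 = (b₀ ^ 2) ^ 2 by ring, hb2]
    field_simp
    ring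
  have hsb : (4 / α * b₀) ^ 2 + ((4 / α + 2) * b₀) ^ 2 = 1 := by
    rw [mul_pow, mul_pow, hb2]
    field_simp
    ring
  have hω₀ : (4 / α * b₀) ^ 2 * ((4 / α + 2) * b₀) ^ 2 = ω₀ := by
    rw [mul_pow, mul_pow, hb2, hω, show α ^ 4 + 8 * α ^ 3 + 32 * α ^ 2 + 64 * α + 64
      = (α ^ 2 + 4 * α + 8) ^ 2 by ring]
    field_simp
    ring
  have hω0 : 0 < ω₀ := by rw [hω]; positivity
  have hω4 : ω₀ < 1 / 4 := by
    rw [hω, div_lt_iff₀ (by positivity)]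
    have : 0 < α ^ 2 * (α + 4) ^ 2 := by positivity
    nlinarith
  have hαs : α * (4 / α) = 4 := by field_simp
  have hs : 0 < 4 / α := by positivity
  have hφ' : φ = fun x => a₀ * cosh (b₀ * x) ^ (-(4 / α)) := by
    ext x
    rw [hφ, inv_rpow (cosh_pos _).le, rpow_neg (cosh_pos _).le]
  have hφ0 : ∀ x, 0 < φ x := fun x => by
    rw [hφ']
    exact mul_pos ha0 (rpow_pos_of_pos (cosh_pos _) _)
  obtain ⟨ε₁, hε₁, K, hK, U, hU, hU0, hUK⟩ := exists_curve_of_waveMap hα ha0 hs hb0 hαs haα hsb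
  obtain ⟨r, hr, ε₂, hε₂, huniq⟩ := exists_unique_radius hα ha0 hs hb0 hαs haα hsb
  rw [hω₀] at hU huniq
  rw [← hφ'] at hU0
  simp only [show ∀ x, a₀ * cosh (b₀ * x) ^ (-(4 / α)) = φ x from fun x => by rw [hφ']] at huniq
  have hη : 0 < min ((ω₀ / 4) ^ α⁻¹) (φ 0 / 2) := lt_min (by positivity) (half_pos (hφ0 0))
  set η := min ((ω₀ / 4) ^ α⁻¹) (φ 0 / 2) with hηdef
  have hηα : η ^ α ≤ ω₀ / 4 := by
    refine (rpow_le_rpow hη.le (min_le_left _ _) hα.le).trans_eq ?_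
    rw [← rpow_mul (by positivity), inv_mul_cancel₀ hα.ne', rpow_one]
  have hηφ : η < φ 0 := (min_le_right _ _).trans_lt (half_lt_self (hφ0 0))
  set δ := min r η with hδdef
  have hδ : 0 < δ := lt_min hr hη
  set ε := min (min ε₁ ε₂) (min (min (ω₀ / 2) (1 / 4 - ω₀)) (δ / (2 * K))) with hε
  have hε0 : 0 < ε := lt_min (lt_min hε₁ hε₂)
    (lt_min (lt_min (by positivity) (by linarith)) (by positivity))
  have hφw : IsEvenWave α ω₀ φ := by
    simpa [hU0] using hU 0 (by simpa using hε₁.le)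
  have hmem : ∀ ω ∈ Set.Ioo (ω₀ - ε) (ω₀ + ε), |ω - ω₀| < ε := fun ω h =>
    abs_lt.mpr ⟨by linarith [h.1], by linarith [h.2]⟩
  have hwave : ∀ ω ∈ Set.Ioo (ω₀ - ε) (ω₀ + ε), IsEvenWave α ω (U (ω - ω₀)) := fun ω h => by
    simpa using hU (ω - ω₀) ((hmem ω h).le.trans ((min_le_left _ _).trans (min_le_left _ _)))
  have hclose : ∀ {ω} {u : ℝ → ℝ}, IsEvenWave α ω u → distH4sq u φ < δ ^ 2 → ∀ x, |u x - φ x| ≤ δ :=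
    fun hu hd x => abs_le_of_sq_le_sq ((sq_sub_le_distH4sq hu.contDiff hφw.contDiff hu.integrable
      hφw.integrable x).trans hd.le) hδ.le
  have hdist : ∀ ω ∈ Set.Ioo (ω₀ - ε) (ω₀ + ε), distH4sq (U (ω - ω₀)) φ < δ ^ 2 := fun ω h => by
    have h1 := hUK (ω - ω₀) 0 ((hmem ω h).le.trans ((min_le_left _ _).trans (min_le_left _ _)))
      (by simpa using hε₁.le)
    rw [hU0, sub_zero] at h1
    refine h1.trans_lt (pow_lt_pow_left₀ ?_ (by positivity) two_ne_zero)
    have h2 : |ω - ω₀| < δ / (2 * K) := (hmem ω h).trans_le ((min_le_right _ _).trans (min_le_right _ _))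
    rw [lt_div_iff₀ (by positivity)] at h2
    nlinarith [abs_nonneg (ω - ω₀)]
  refine ⟨ε, δ, hε0, hδ, fun ω => U (ω - ω₀), ?_, fun ω h => ?_, fun ω h η' hη' => ?_⟩
  · simpa using hU0
  · have hw := hwave ω h
    have hc := hclose hw (hdist ω h)
    have hlt := hmem ω h
    have e1 : |ω - ω₀| < ω₀ / 2 := hlt.trans_le
      ((min_le_right _ _).trans ((min_le_left _ _).trans (min_le_left _ _)))
    have e2 : |ω - ω₀| < 1 / 4 - ω₀ := hlt.trans_le
      ((min_le_right _ _).trans ((min_le_left _ _).trans (min_le_right _ _)))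
    refine ⟨hw.contDiff, hw.even, ?_, hw.integrable, hw.equation, hdist ω h,
      fun ψ h1 h2 h3 h4 h5 => ?_⟩
    · exact hw.pos hα (by linarith [(abs_lt.mp e1).1]) (by linarith [(abs_lt.mp e2).2]) hφ0
        (by linarith [(abs_lt.mp e1).1]) hηφ fun x => (hc x).trans (min_le_right _ _)
    · have hψ : IsEvenWave α ω ψ := ⟨h1, h2, h3, h4⟩
      exact huniq (ω - ω₀) (hlt.le.trans ((min_le_left _ _).trans (min_le_right _ _))) ψ _
        (by simpa using hψ) (by simpa using hw)
        (fun x => (hclose hψ h5 x).trans (min_le_left _ _)) fun x => (hc x).trans (min_le_left _ _)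
  · refine ⟨η' / K, by positivity, fun ω' h' hlt => ?_⟩
    refine (hUK _ _ ((hmem ω' h').le.trans ((min_le_left _ _).trans (min_le_left _ _)))
      ((hmem ω h).le.trans ((min_le_left _ _).trans (min_le_left _ _)))).trans_lt
      (pow_lt_pow_left₀ ?_ (by positivity) two_ne_zero)
    rw [sub_sub_sub_cancel_right, mul_comm]
    exact (lt_div_iff₀ hK).mp hlt
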